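/- Let (X,d) be a compact metric space and f: X → X a topologically mixing homeomorphism with the exponential shadowing property, and let A: X → GL(m,ℝ) be a Hölder continuous matrix function. Then either (1) all ergodic f-invariant measures have the same maximal Lyapunov exponent with respect to A; or (2) the ML-irregular set MLI(A,f) satisfies h_top(f, MLI(A,f)) = h_top(f), h^P_top(f, MLI(A,f)) = h_top(f), and h^B_top(f, MLI(A,f)) ≥ sup{ h_μ(f) : μ ergodic and μ is not Lyapunov-minimizing for A }. -/

import Mathlib

open Filter MeasureTheory Set Topology Manifold
open scoped ENNReal NNReal

section EntropyDefs

variable {X : Type*} [MetricSpace X]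

/-- The open dynamical (Bowen) ball `B_n(x,r) = {y | d_n(x,y) < r}`. -/
def dynBall (f : X → X) (x : X) (n : ℕ) (r : ℝ) : Set X :=
  {y | ∀ i < n, dist (f^[i] x) (f^[i] y) < r}

/-- The closed dynamical (Bowen) ball `{y | d_n(x,y) ≤ r}`. -/
def dynCBall (f : X → X) (x : X) (n : ℕ) (r : ℝ) : Set X :=
  {y | ∀ i < n, dist (f^[i] x) (f^[i] y) ≤ r}

/-- `S` is an `(n,ε)`-separated subset of `E`. -/
def IsDynSep (f : X → X) (E : Set X) (n : ℕ) (ε : ℝ) (S : Set X) : Prop :=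
  S ⊆ E ∧ ∀ x ∈ S, ∀ y ∈ S, x ≠ y → ∃ i < n, ε < dist (f^[i] x) (f^[i] y)

/-- The maximal cardinality `s_n(E,ε)` of an `(n,ε)`-separated subset of `E`. -/
noncomputable def sepCount (f : X → X) (E : Set X) (n : ℕ) (ε : ℝ) : ℕ :=
  sSup {k | ∃ S : Finset X, IsDynSep f E n ε ↑S ∧ S.card = k}

/-- Bowen's separated-set topological entropy of a compact set:
`lim_{ε→0} limsup_n (1/n) log s_n(E,ε)`. -/
noncomputable def compactEnt (f : X → X) (E : Set X) : EReal :=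
  ⨆ (ε : ℝ) (_ : 0 < ε),
    Filter.limsup (fun n : ℕ => ((Real.log (sepCount f E n ε) / n : ℝ) : EReal)) Filter.atTop

/-- Topological entropy of an arbitrary subset `Y`: the supremum over compact `E ⊆ Y`. -/
noncomputable def topEnt (f : X → X) (Y : Set X) : EReal :=
  ⨆ (E : Set X) (_ : IsCompact E) (_ : E ⊆ Y), compactEnt f E

/-- The sum `Σ e^{-t·u}` over a family of Bowen balls recorded as center/order pairs. -/
noncomputable def bowenSum (t : ℝ) (s : Set (X × ℕ)) : ℝ≥0∞ :=
  ∑' p : s, ENNReal.ofReal (Real.exp (-t * ((p : X × ℕ).2 : ℝ)))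

/-- `C(E;t,n,σ,f)`: infimum of `Σ e^{-t·u}` over countable covers of `E` by Bowen
balls `B_u(x,σ)` with `u ≥ n`. -/
noncomputable def bowenCn (f : X → X) (E : Set X) (t : ℝ) (σ : ℝ) (n : ℕ) : ℝ≥0∞ :=
  ⨅ (s : Set (X × ℕ)) (_ : s.Countable) (_ : ∀ p ∈ s, n ≤ p.2)
    (_ : E ⊆ ⋃ p ∈ s, dynBall f p.1 p.2 σ), bowenSum t s

/-- `C(E;t,σ,f) = lim_{n→∞} C(E;t,n,σ,f)` (the limit of the nondecreasing sequence). -/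
noncomputable def bowenC (f : X → X) (E : Set X) (t : ℝ) (σ : ℝ) : ℝ≥0∞ :=
  ⨆ n : ℕ, bowenCn f E t σ n

/-- Bowen–Hausdorff entropy at scale `σ`: `inf {t | C(E;t,σ,f) = 0}`. -/
noncomputable def bowenEntAt (f : X → X) (E : Set X) (σ : ℝ) : EReal :=
  sInf {t : EReal | ∃ t' : ℝ, t = (t' : EReal) ∧ bowenC f E t' σ = 0}

/-- Bowen–Hausdorff entropy `h^B_top(f,E) = lim_{σ→0} h^B_top(E;σ,f)`. -/
noncomputable def bowenEnt (f : X → X) (E : Set X) : EReal :=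
  ⨆ (σ : ℝ) (_ : 0 < σ), bowenEntAt f E σ

/-- Feng–Huang packing pre-measure `P^s_{N,ε}(E)`: supremum of `Σ e^{-s·n_i}` over countable
pairwise disjoint families of closed Bowen balls of orders `n_i ≥ N` centered in `E`. -/
noncomputable def packPre (f : X → X) (s : ℝ) (N : ℕ) (ε : ℝ) (E : Set X) : ℝ≥0∞ :=
  ⨆ (D : Set (X × ℕ)) (_ : D.Countable) (_ : ∀ p ∈ D, p.1 ∈ E ∧ N ≤ p.2)
    (_ : D.Pairwise fun p q => Disjoint (dynCBall f p.1 p.2 ε) (dynCBall f q.1 q.2 ε)),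
    ∑' p : D, ENNReal.ofReal (Real.exp (-s * ((p : X × ℕ).2 : ℝ)))

/-- `P^s_ε(E) = lim_{N→∞} P^s_{N,ε}(E)` (the limit of the nonincreasing sequence). -/
noncomputable def packPreLim (f : X → X) (s ε : ℝ) (E : Set X) : ℝ≥0∞ :=
  ⨅ N : ℕ, packPre f s N ε E

/-- Feng–Huang packing measure `𝒫^s_ε(E) = inf {Σ_i P^s_ε(E_i) | E ⊆ ⋃ E_i}`. -/
noncomputable def packMeas (f : X → X) (s ε : ℝ) (E : Set X) : ℝ≥0∞ :=
  ⨅ (C : ℕ → Set X) (_ : E ⊆ ⋃ i, C i), ∑' i, packPreLim f s ε (C i)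

/-- Packing topological entropy at scale `ε`: the critical exponent of `s ↦ 𝒫^s_ε(E)`. -/
noncomputable def packEntAt (f : X → X) (E : Set X) (ε : ℝ) : EReal :=
  sInf {t : EReal | ∃ t' : ℝ, t = (t' : EReal) ∧ packMeas f t' ε E = 0}

/-- Packing topological entropy `h^P_top(f,E) = lim_{ε→0} h^P_top(f,E,ε)`. -/
noncomputable def packEnt (f : X → X) (E : Set X) : EReal :=
  ⨆ (ε : ℝ) (_ : 0 < ε), packEntAt f E ε

/-- The restriction of `f` to `Λ` is topologically mixing. -/
def TopMixingOn (f : X → X) (Λ : Set X) : Prop :=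
  ∀ U V : Set X, IsOpen U → IsOpen V → (U ∩ Λ).Nonempty → (V ∩ Λ).Nonempty →
    ∃ N : ℕ, ∀ n ≥ N, (f^[n] '' (U ∩ Λ) ∩ (V ∩ Λ)).Nonempty

end EntropyDefs

section MetricEntropy

variable {X : Type*} [MeasurableSpace X]

/-- Entropy `H_μ(⋁_{i=0}^{n-1} f^{-i} ξ)` of the `n`-th dynamical refinement of the finite
measurable partition `ξ = {P⁻¹(c)}_{c}`. -/
noncomputable def partHn (f : X → X) (μ : MeasureTheory.Measure X) {k : ℕ}
    (P : X → Fin k) (n : ℕ) : ℝ :=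
  ∑ c : Fin n → Fin k,
    Real.negMulLog (μ {x | ∀ i : Fin n, P (f^[(i : ℕ)] x) = c i}).toReal

/-- Kolmogorov–Sinai metric entropy `h_μ(f)`: the supremum over finite measurable partitions of
`lim_n (1/n) H_μ(⋁_{i<n} f^{-i} ξ) = inf_{n ≥ 1} (1/n) H_μ(⋁_{i<n} f^{-i} ξ)`. -/
noncomputable def ksEnt (f : X → X) (μ : MeasureTheory.Measure X) : EReal :=
  ⨆ (k : ℕ) (P : X → Fin k) (_ : Measurable P),
    (((⨅ n : ℕ, partHn f μ P (n + 1) / ((n : ℝ) + 1)) : ℝ) : EReal)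

end MetricEntropy

section CocycleDefs

/-- Euclidean space `ℝ^m`. -/
abbrev Em (m : ℕ) := EuclideanSpace ℝ (Fin m)

variable {X : Type*} {m : ℕ}

/-- The cocycle generated by the `GL(m,ℝ)`-valued function `A` over `f`:
`A(x,n) = A(f^{n-1}x) ⋯ A(f x) A(x)`. -/
noncomputable def cocycle (f : X → X) (A : X → (Em m ≃L[ℝ] Em m)) (x : X) :
    ℕ → (Em m →L[ℝ] Em m)
  | 0 => ContinuousLinearMap.id ℝ (Em m)
  | n + 1 => ((A (f^[n] x) : Em m →L[ℝ] Em m)).comp (cocycle f A x n)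

/-- `A` is an `α`-Hölder continuous matrix function for some exponent `α > 0`
(in the operator norm). -/
def HolderMat [MetricSpace X] (A : X → (Em m ≃L[ℝ] Em m)) : Prop :=
  ∃ α C : ℝ, 0 < α ∧ 0 ≤ C ∧ ∀ x y : X,
    ‖((A x : Em m →L[ℝ] Em m)) - ((A y : Em m →L[ℝ] Em m))‖ ≤ C * dist x y ^ α

/-- The set `MLI(A,f)` of Max-Lyapunov-irregular points: points where
`lim_n (1/n) log ‖A(x,n)‖` does not exist. -/
def MLIrr (f : X → X) (A : X → (Em m ≃L[ℝ] Em m)) : Set X :=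
  {x | ¬ ∃ c : ℝ,
    Filter.Tendsto (fun n : ℕ => Real.log ‖cocycle f A x n‖ / n) Filter.atTop (nhds c)}

/-- The maximal Lyapunov exponent of an invariant measure:
`χ_max(A,μ) = lim_n (1/n) ∫ log ‖A(x,n)‖ dμ = inf_{n ≥ 1} (1/n) ∫ log ‖A(x,n)‖ dμ`. -/
noncomputable def mle [MeasurableSpace X] (f : X → X) (A : X → (Em m ≃L[ℝ] Em m))
    (μ : MeasureTheory.Measure X) : ℝ :=
  ⨅ n : ℕ, (∫ x, Real.log ‖cocycle f A x (n + 1)‖ ∂μ) / ((n : ℝ) + 1)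

/-- `μ` is a Lyapunov-minimizing (ergodic) measure for the cocycle `A`:
`χ_max(A,μ) = inf {χ_max(A,ν) : ν an f-invariant Borel probability measure}`. -/
def IsLyapMin [MeasurableSpace X] (f : X → X) (A : X → (Em m ≃L[ℝ] Em m))
    (μ : MeasureTheory.Measure X) : Prop :=
  mle f A μ = sInf {r : ℝ | ∃ ν : MeasureTheory.Measure X,
    MeasureTheory.IsProbabilityMeasure ν ∧ MeasureTheory.MeasurePreserving f ν ν ∧
    r = mle f A ν}

end CocycleDefs

section ShadowingDefs

variable {X : Type*} [MetricSpace X]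

/-- The cumulative times `c_i` associated with a sequence of block lengths `(n_i)_{i∈ℤ}`. -/
def csum (nseq : ℤ → ℕ) (i : ℤ) : ℤ :=
  if 0 ≤ i then ∑ j ∈ Finset.range i.toNat, (nseq j : ℤ)
  else -∑ j ∈ Finset.range (-i).toNat, (nseq (i + j) : ℤ)

/-- `{x_i, n_i}_{i∈ℤ}` is a `δ`-pseudo-orbit for `f`: `d(f^{n_i}(x_i), x_{i+1}) < δ`. -/
def IsPseudoOrbit (f : X → X) (δ : ℝ) (x : ℤ → X) (nseq : ℤ → ℕ) : Prop :=
  (∀ i, 1 ≤ nseq i) ∧ ∀ i : ℤ, dist (f^[nseq i] (x i)) (x (i + 1)) < δ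

/-- `p` is a `(τ,λ)`-shadowing point for the pseudo-orbit `{x_i, n_i}`:
`d(f^{c_i+j}(p), f^j(x_i)) < τ e^{-λ min{j, n_i - j}}` for `0 ≤ j ≤ n_i - 1`, `i ∈ ℤ`. -/
def IsExpShadowed (f : X ≃ X) (τ lam : ℝ) (x : ℤ → X) (nseq : ℤ → ℕ) (p : X) : Prop :=
  ∀ i : ℤ, ∀ j < nseq i,
    dist ((f ^ (csum nseq i + (j : ℤ)) : X ≃ X) p) ((⇑f)^[j] (x i))
      < τ * Real.exp (-lam * ((min j (nseq i - j) : ℕ) : ℝ))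

/-- The `λ`-exponential shadowing property. -/
def ExpShadowingWith (f : X ≃ X) (lam : ℝ) : Prop :=
  ∀ τ > (0 : ℝ), ∃ δ > (0 : ℝ), ∀ (x : ℤ → X) (nseq : ℤ → ℕ),
    IsPseudoOrbit (⇑f) δ x nseq → ∃ p : X, IsExpShadowed f τ lam x nseq p

/-- The exponential shadowing property: `λ`-exponential shadowing for some `λ > 0`. -/
def ExpShadowing (f : X ≃ X) : Prop := ∃ lam > (0 : ℝ), ExpShadowingWith f lam

end ShadowingDefs

section CocycleBasics

variable {X : Type*} {m : ℕ}

/-- The matrices `A x` and their inverses are bounded in norm by `e^M`. -/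
def LogBounded (A : X → (Em m ≃L[ℝ] Em m)) (M : ℝ) : Prop :=
  ∀ x, ‖(A x : Em m →L[ℝ] Em m)‖ ≤ Real.exp M ∧
    ‖((A x).symm : Em m →L[ℝ] Em m)‖ ≤ Real.exp M

/-- The logarithmic growth `log ‖A(x,n)‖`. -/
noncomputable def logGrowth (f : X → X) (A : X → (Em m ≃L[ℝ] Em m)) (x : X) (n : ℕ) : ℝ :=
  Real.log ‖cocycle f A x n‖

theorem HolderMat.continuous [MetricSpace X] {A : X → (Em m ≃L[ℝ] Em m)} (hA : HolderMat A) :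
    Continuous fun x => (A x : Em m →L[ℝ] Em m) := by
  obtain ⟨α, C, hα, -, h⟩ := hA
  rw [continuous_iff_continuousAt]
  intro x
  rw [ContinuousAt, tendsto_iff_norm_sub_tendsto_zero]
  refine squeeze_zero (fun _ => norm_nonneg _) (fun y => h y x) ?_
  have h1 : Tendsto (fun y => dist y x) (𝓝 x) (𝓝 0) := by
    simpa using (continuous_id.dist (continuous_const (y := x))).tendsto x
  have h2 := (h1.rpow_const (p := α) (Or.inr hα.le)).const_mul C
  simpa [Real.zero_rpow hα.ne'] using h2

theorem exists_logBounded [MetricSpace X] [CompactSpace X] {A : X → (Em m ≃L[ℝ] Em m)}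
    (hA : Continuous fun x => (A x : Em m →L[ℝ] Em m)) : ∃ M, 1 ≤ M ∧ LogBounded A M := by
  have hinv : Continuous fun x => ((A x).symm : Em m →L[ℝ] Em m) := by
    have : (fun x => ((A x).symm : Em m →L[ℝ] Em m)) =
        fun x => Ring.inverse (A x : Em m →L[ℝ] Em m) := by
      funext x
      rw [ContinuousLinearMap.ringInverse_equiv, ContinuousLinearMap.inverse_equiv]
    rw [this, continuous_iff_continuousAt]
    intro x
    have := NormedRing.inverse_continuousAt
      (ContinuousLinearEquiv.toUnit (A x) : (Em m →L[ℝ] Em m)ˣ)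
    exact ContinuousAt.comp (f := fun x => (A x : Em m →L[ℝ] Em m)) this hA.continuousAt
  obtain ⟨a, ha⟩ := (isCompact_range hA.norm).bddAbove
  obtain ⟨b, hb⟩ := (isCompact_range hinv.norm).bddAbove
  refine ⟨max 1 (max a b), le_max_left _ _, fun x => ⟨?_, ?_⟩⟩
  · calc _ ≤ a := ha (mem_range_self x)
      _ ≤ max 1 (max a b) := (le_max_left a b).trans (le_max_right _ _)
      _ ≤ _ := (by linarith [Real.add_one_le_exp (max 1 (max a b))])
  · calc _ ≤ b := hb (mem_range_self x)
      _ ≤ max 1 (max a b) := (le_max_right a b).trans (le_max_right _ _)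
      _ ≤ _ := (by linarith [Real.add_one_le_exp (max 1 (max a b))])

variable {f : X → X} {A : X → (Em m ≃L[ℝ] Em m)} {M : ℝ}

theorem cocycle_add (x : X) (n k : ℕ) :
    cocycle f A x (n + k) = (cocycle f A (f^[n] x) k).comp (cocycle f A x n) := by
  induction k with
  | zero => ext; simp [cocycle]
  | succ k ih =>
    rw [← add_assoc, cocycle, ih, cocycle, ContinuousLinearMap.comp_assoc,
      ← Function.iterate_add_apply, Nat.add_comm k n]

theorem exists_equiv_eq_cocycle (hM : LogBounded A M) (x : X) (n : ℕ) :
    ∃ e : Em m ≃L[ℝ] Em m, (e : Em m →L[ℝ] Em m) = cocycle f A x n ∧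
      ‖(e.symm : Em m →L[ℝ] Em m)‖ ≤ Real.exp (M * n) := by
  induction n with
  | zero =>
    refine ⟨ContinuousLinearEquiv.refl ℝ _, rfl, ?_⟩
    simpa using ContinuousLinearMap.norm_id_le
  | succ n ih =>
    obtain ⟨e, he, hn⟩ := ih
    refine ⟨e.trans (A (f^[n] x)), ?_, ?_⟩
    · rw [cocycle, ← he]; rfl
    · have : ((e.trans (A (f^[n] x))).symm : Em m →L[ℝ] Em m) =
          (e.symm : Em m →L[ℝ] Em m).comp ((A (f^[n] x)).symm : Em m →L[ℝ] Em m) := rfl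
      rw [this]
      calc _ ≤ ‖(e.symm : Em m →L[ℝ] Em m)‖ * ‖((A (f^[n] x)).symm : Em m →L[ℝ] Em m)‖ :=
            ContinuousLinearMap.opNorm_comp_le _ _
        _ ≤ Real.exp (M * n) * Real.exp M := by gcongr; exact (hM _).2
        _ = _ := by rw [← Real.exp_add]; congr 1; push_cast; ring

theorem norm_cocycle_pos [NeZero m] (hM : LogBounded A M) (x : X) (n : ℕ) :
    0 < ‖cocycle f A x n‖ := by
  obtain ⟨e, he, -⟩ := exists_equiv_eq_cocycle (f := f) hM x n
  rw [← he, norm_pos_iff]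
  intro h0
  obtain ⟨v, hv⟩ := exists_ne (0 : Em m)
  have : e v = 0 := by
    have := congrArg (fun T : Em m →L[ℝ] Em m => T v) h0
    simpa using this
  exact hv (by simpa using this)

theorem exp_logGrowth [NeZero m] (hM : LogBounded A M) (x : X) (n : ℕ) :
    Real.exp (logGrowth f A x n) = ‖cocycle f A x n‖ :=
  Real.exp_log (norm_cocycle_pos hM x n)

theorem logGrowth_add_le [NeZero m] (hM : LogBounded A M) (x : X) (n k : ℕ) :
    logGrowth f A x (n + k) ≤ logGrowth f A x n + logGrowth f A (f^[n] x) k := by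
  unfold logGrowth
  rw [← Real.log_mul (norm_cocycle_pos hM x n).ne' (norm_cocycle_pos hM _ k).ne']
  apply Real.log_le_log (norm_cocycle_pos hM x _)
  rw [cocycle_add, mul_comm]
  exact ContinuousLinearMap.opNorm_comp_le _ _

theorem logGrowth_le [NeZero m] (hM : LogBounded A M) (x : X) (n : ℕ) :
    logGrowth f A x n ≤ M * n := by
  rw [← Real.exp_le_exp, exp_logGrowth hM]
  induction n with
  | zero => simp [cocycle]
  | succ n ih =>
    rw [cocycle]
    calc _ ≤ ‖(A (f^[n] x) : Em m →L[ℝ] Em m)‖ * ‖cocycle f A x n‖ :=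
          ContinuousLinearMap.opNorm_comp_le _ _
      _ ≤ Real.exp M * Real.exp (M * n) := by gcongr; exact (hM _).1
      _ = _ := by rw [← Real.exp_add]; congr 1; push_cast; ring

theorem logGrowth_shift_le [NeZero m] (hM : LogBounded A M) (x : X) (n k : ℕ) :
    logGrowth f A (f^[n] x) k ≤ logGrowth f A x (n + k) + M * n := by
  rw [← Real.exp_le_exp, Real.exp_add, exp_logGrowth hM, exp_logGrowth hM]
  obtain ⟨e, he, hn⟩ := exists_equiv_eq_cocycle (f := f) hM x n
  have : cocycle f A (f^[n] x) k =
      (cocycle f A x (n + k)).comp (e.symm : Em m →L[ℝ] Em m) := by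
    rw [cocycle_add, ← he]
    ext v
    simp
  rw [this]
  refine (ContinuousLinearMap.opNorm_comp_le _ _).trans ?_
  gcongr

theorem le_logGrowth_add [NeZero m] (hM : LogBounded A M) (x : X) (n k : ℕ) :
    logGrowth f A x n ≤ logGrowth f A x (n + k) + M * k := by
  rw [← Real.exp_le_exp, Real.exp_add, exp_logGrowth hM, exp_logGrowth hM]
  obtain ⟨e, he, hn⟩ := exists_equiv_eq_cocycle (f := f) hM (f^[n] x) k
  have : cocycle f A x n = (e.symm : Em m →L[ℝ] Em m).comp (cocycle f A x (n + k)) := by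
    rw [cocycle_add, ← he]
    ext v
    simp
  rw [this, mul_comm]
  refine (ContinuousLinearMap.opNorm_comp_le _ _).trans ?_
  gcongr

theorem logGrowth_zero [NeZero m] (x : X) : logGrowth f A x 0 = 0 := by
  simp [logGrowth, cocycle]

theorem neg_le_logGrowth [NeZero m] (hM : LogBounded A M) (x : X) (n : ℕ) :
    -(M * n) ≤ logGrowth f A x n := by
  have := le_logGrowth_add (f := f) hM x 0 n
  rw [logGrowth_zero, zero_add] at this
  linarith

theorem abs_logGrowth_le [NeZero m] (hM : LogBounded A M) (x : X) (n : ℕ) :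
    |logGrowth f A x n| ≤ M * n :=
  abs_le.2 ⟨neg_le_logGrowth hM x n, logGrowth_le hM x n⟩

/-- Up to a constant, `log ‖A(x,n)‖` is bounded by the Birkhoff sum of `log ‖A(·,L)‖ / L`. -/
theorem logGrowth_le_sum [NeZero m] (hM : LogBounded A M) {L : ℕ} (hL : 0 < L)
    (x : X) (n : ℕ) :
    logGrowth f A x n ≤
      ∑ l ∈ Finset.range n, logGrowth f A (f^[l] x) L / L + 2 * M * L := by
  have hM0 : ∀ k : ℕ, 0 ≤ M * k := fun k => (abs_nonneg _).trans (abs_logGrowth_le (f := f) hM x k)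
  have window : ∀ n, ∑ r ∈ Finset.range L, logGrowth f A x (n + r) ≤
      ∑ r ∈ Finset.range L, logGrowth f A x r +
        ∑ l ∈ Finset.range n, logGrowth f A (f^[l] x) L := by
    intro n
    induction n with
    | zero => simp
    | succ n ih =>
      have h1 : ∑ r ∈ Finset.range L, logGrowth f A x (n + 1 + r) + logGrowth f A x n =
          ∑ r ∈ Finset.range L, logGrowth f A x (n + r) + logGrowth f A x (n + L) := by
        rw [← Finset.sum_range_succ (fun r => logGrowth f A x (n + r)), Finset.sum_range_succ']
        simp [add_assoc, add_comm 1]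
      rw [Finset.sum_range_succ]
      linarith [logGrowth_add_le (f := f) hM x n L]
  have h1 : ∑ r ∈ Finset.range L, (logGrowth f A x n - M * L) ≤
      ∑ r ∈ Finset.range L, logGrowth f A x (n + r) := by
    refine Finset.sum_le_sum fun r hr => ?_
    have h2 : M * r ≤ M * L := by
      have h3 : (r : ℝ) ≤ L := by exact_mod_cast (Finset.mem_range.1 hr).le
      have h4 : 0 ≤ M := by simpa using hM0 1
      gcongr
    linarith [le_logGrowth_add (f := f) hM x n r]
  have h2 : ∑ r ∈ Finset.range L, logGrowth f A x r ≤ ∑ r ∈ Finset.range L, M * (L : ℝ) := by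
    refine Finset.sum_le_sum fun r hr => ?_
    have h3 : (r : ℝ) ≤ L := by exact_mod_cast (Finset.mem_range.1 hr).le
    have h4 : 0 ≤ M := by simpa using hM0 1
    exact (logGrowth_le hM x r).trans (by gcongr)
  simp only [Finset.sum_const, Finset.card_range, nsmul_eq_mul] at h1 h2
  rw [← Finset.sum_div]
  have hL' : (0 : ℝ) < L := by exact_mod_cast hL
  have h3 := window n
  have h4 : (logGrowth f A x n - 2 * M * L) * L ≤
      ∑ l ∈ Finset.range n, logGrowth f A (f^[l] x) L := by linarith
  linarith [(le_div_iff₀ hL').2 h4]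

theorem continuous_cocycle [MetricSpace X] (hf : Continuous f)
    (hA : Continuous fun x => (A x : Em m →L[ℝ] Em m)) (n : ℕ) :
    Continuous fun x => cocycle f A x n := by
  induction n with
  | zero => exact continuous_const
  | succ n ih => exact (hA.comp (hf.iterate n)).clm_comp ih

theorem continuous_logGrowth [NeZero m] [MetricSpace X] (hM : LogBounded A M)
    (hf : Continuous f) (hA : Continuous fun x => (A x : Em m →L[ℝ] Em m)) (n : ℕ) :
    Continuous fun x => logGrowth f A x n :=
  (continuous_cocycle hf hA n).norm.log fun x => (norm_cocycle_pos hM x n).ne'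

theorem exists_integral_lt_of_mle_lt [MeasurableSpace X] {μ : Measure X} {χ : ℝ} (h : mle f A μ < χ) :
    ∃ L : ℕ, 0 < L ∧ ∫ x, logGrowth f A x L / L ∂μ < χ := by
  obtain ⟨n, hn⟩ := exists_lt_of_ciInf_lt h
  refine ⟨n + 1, n.succ_pos, ?_⟩
  rw [integral_div]
  push_cast
  exact hn

section Mle

variable [MetricSpace X] [CompactSpace X] [MeasurableSpace X] [BorelSpace X]

theorem integrable_logGrowth [NeZero m] (hM : LogBounded A M) (hf : Continuous f)
    (hA : Continuous fun x => (A x : Em m →L[ℝ] Em m)) (μ : Measure X) [IsProbabilityMeasure μ]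
    (n : ℕ) : Integrable (fun x => logGrowth f A x n) μ :=
  (continuous_logGrowth hM hf hA n).integrable_of_hasCompactSupport
    (HasCompactSupport.of_compactSpace _)

theorem bddBelow_mle [NeZero m] (hM : LogBounded A M) (hf : Continuous f)
    (hA : Continuous fun x => (A x : Em m →L[ℝ] Em m)) (μ : Measure X) [IsProbabilityMeasure μ] :
    -M ∈ lowerBounds (range fun n : ℕ => (∫ x, logGrowth f A x (n + 1) ∂μ) / ((n : ℝ) + 1)) := by
  rintro _ ⟨n, rfl⟩
  show -M ≤ _ / _
  rw [le_div_iff₀ (by positivity)]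
  have := integral_mono (integrable_const (-(M * (n + 1 : ℕ))))
    (integrable_logGrowth (f := f) hM hf hA μ (n + 1)) (fun x => neg_le_logGrowth hM x (n + 1))
  simp only [integral_const, probReal_univ, smul_eq_mul, one_mul] at this
  push_cast at this
  linarith

theorem mle_mul_le_integral [NeZero m] (hM : LogBounded A M) (hf : Continuous f)
    (hA : Continuous fun x => (A x : Em m →L[ℝ] Em m)) (μ : Measure X) [IsProbabilityMeasure μ]
    (n : ℕ) : mle f A μ * n ≤ ∫ x, logGrowth f A x n ∂μ := by
  cases n with
  | zero => simp [logGrowth_zero]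
  | succ n =>
    have h : mle f A μ ≤ (∫ x, logGrowth f A x (n + 1) ∂μ) / ((n : ℝ) + 1) :=
      ciInf_le ⟨-M, bddBelow_mle hM hf hA μ⟩ n
    rw [le_div_iff₀ (by positivity)] at h
    exact_mod_cast h

theorem neg_le_mle [NeZero m] (hM : LogBounded A M) (hf : Continuous f)
    (hA : Continuous fun x => (A x : Em m →L[ℝ] Em m)) (μ : Measure X) [IsProbabilityMeasure μ] :
    -M ≤ mle f A μ :=
  le_ciInf fun n => bddBelow_mle hM hf hA μ (mem_range_self n)

end Mle

end CocycleBasics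

section Perturbation

variable {R : Type*} [NormedRing R]

/-- The product `B_{j-1} ⋯ B_i` over the interval `[i, j)`. -/
def ivlProd (B : ℕ → R) (i : ℕ) : ℕ → R
  | 0 => 1
  | j + 1 => if i ≤ j then B j * ivlProd B i j else 1

theorem ivlProd_self (B : ℕ → R) (i : ℕ) : ivlProd B i i = 1 := by
  cases i <;> simp [ivlProd]

theorem ivlProd_succ (B : ℕ → R) {i j : ℕ} (h : i ≤ j) :
    ivlProd B i (j + 1) = B j * ivlProd B i j := by
  simp [ivlProd, h]

theorem ivlProd_mul (B : ℕ → R) {i j k : ℕ} (hij : i ≤ j) (hjk : j ≤ k) :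
    ivlProd B j k * ivlProd B i j = ivlProd B i k := by
  induction k, hjk using Nat.le_induction with
  | base => rw [ivlProd_self, one_mul]
  | succ k hk ih => rw [ivlProd_succ B hk, ivlProd_succ B (hij.trans hk), mul_assoc, ih]

theorem ivlProd_eq_add_sum (B B' : ℕ → R) {i j : ℕ} (h : i ≤ j) :
    ivlProd B' i j = ivlProd B i j +
      ∑ l ∈ Finset.Ico i j, ivlProd B (l + 1) j * (B' l - B l) * ivlProd B' i l := by
  induction j, h using Nat.le_induction with
  | base => simp [ivlProd_self]
  | succ j hj ih =>
    rw [Finset.sum_Ico_succ_top hj, ivlProd_self, one_mul]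
    have : ∑ l ∈ Finset.Ico i j, ivlProd B (l + 1) (j + 1) * (B' l - B l) * ivlProd B' i l =
        B j * ∑ l ∈ Finset.Ico i j, ivlProd B (l + 1) j * (B' l - B l) * ivlProd B' i l := by
      rw [Finset.mul_sum]
      refine Finset.sum_congr rfl fun l hl => ?_
      rw [ivlProd_succ B (Finset.mem_Ico.1 hl).2]
      simp only [mul_assoc]
    rw [this, ivlProd_succ B' hj, ivlProd_succ B hj, sub_mul, ← add_assoc, ← mul_add, ← ih]
    abel

theorem ivlProd_eq_add_sum' (B B' : ℕ → R) {i j : ℕ} (h : i ≤ j) :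
    ivlProd B' i j = ivlProd B i j +
      ∑ l ∈ Finset.Ico i j, ivlProd B' (l + 1) j * (B' l - B l) * ivlProd B i l := by
  have h1 := ivlProd_eq_add_sum B' B h
  have h2 : ∑ l ∈ Finset.Ico i j, ivlProd B' (l + 1) j * (B' l - B l) * ivlProd B i l =
      -∑ l ∈ Finset.Ico i j, ivlProd B' (l + 1) j * (B l - B' l) * ivlProd B i l := by
    rw [← Finset.sum_neg_distrib]
    refine Finset.sum_congr rfl fun l _ => ?_
    rw [← neg_sub (B l), mul_neg, neg_mul]
  rw [h2, h1]
  abel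

theorem norm_mul_mul_le_of_le {a b c : R} {x y z : ℝ} (ha : ‖a‖ ≤ x) (hb : ‖b‖ ≤ y)
    (hc : ‖c‖ ≤ z) : ‖a * b * c‖ ≤ x * y * z := by
  have hx := (norm_nonneg a).trans ha
  have hy := (norm_nonneg b).trans hb
  calc ‖a * b * c‖ ≤ ‖a‖ * ‖b‖ * ‖c‖ := (norm_mul_le _ _).trans (by gcongr; exact norm_mul_le _ _)
    _ ≤ x * y * z := by gcongr

variable {B B' : ℕ → R} {n : ℕ} {K : ℝ} {S e : ℕ → ℝ}

theorem norm_ivlProd_perturb_le (hK : 0 ≤ K)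
    (hB : ∀ i j, i ≤ j → j ≤ n → ‖ivlProd B i j‖ ≤ K * Real.exp (S j - S i))
    (hE : ∀ l < n, ‖B' l - B l‖ ≤ e l * Real.exp (S (l + 1) - S l))
    (he : ∀ l, 0 ≤ e l) (hsum : K * ∑ l ∈ Finset.range n, e l ≤ 1 / 2)
    {i j : ℕ} (hij : i ≤ j) (hj : j ≤ n) :
    ‖ivlProd B' i j‖ ≤ 2 * K * Real.exp (S j - S i) := by
  induction j using Nat.strong_induction_on with
  | _ j ih =>
  rw [ivlProd_eq_add_sum B B' hij]
  have h1 : ‖∑ l ∈ Finset.Ico i j, ivlProd B (l + 1) j * (B' l - B l) * ivlProd B' i l‖ ≤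
      ∑ l ∈ Finset.Ico i j, K * Real.exp (S j - S i) * (2 * K * e l) := by
    refine norm_sum_le_of_le _ fun l hl => ?_
    obtain ⟨hil, hlj⟩ := Finset.mem_Ico.1 hl
    refine (norm_mul_mul_le_of_le (hB (l + 1) j hlj hj) (hE l (hlj.trans_le hj))
      (ih l hlj hil (hlj.le.trans hj))).trans (le_of_eq ?_)
    have : Real.exp (S j - S i) = Real.exp (S j - S (l + 1)) * Real.exp (S (l + 1) - S l) *
        Real.exp (S l - S i) := by
      rw [← Real.exp_add, ← Real.exp_add]; ring_nf
    rw [this]; ring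
  rw [← Finset.mul_sum, ← Finset.mul_sum] at h1
  have h2 : ∑ l ∈ Finset.Ico i j, e l ≤ ∑ l ∈ Finset.range n, e l := by
    refine Finset.sum_le_sum_of_subset_of_nonneg (fun l hl => ?_) fun l _ _ => he l
    exact Finset.mem_range.2 ((Finset.mem_Ico.1 hl).2.trans_le hj)
  have h3 : 2 * K * ∑ l ∈ Finset.Ico i j, e l ≤ 1 := by nlinarith
  have h4 : K * Real.exp (S j - S i) * (2 * K * ∑ l ∈ Finset.Ico i j, e l) ≤
      K * Real.exp (S j - S i) * 1 := by gcongr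
  refine (norm_add_le _ _).trans ?_
  linarith [hB i j hij hj]

/-- If the norm of `B_{n-1} ⋯ B_0` dominates those of all its subproducts, up to errors growing
slowly with the distance to the ends of `[0,n)`, then small perturbations that decay faster
towards the middle of `[0,n)` reduce this norm by a factor at most `2`. -/
theorem half_norm_le_norm_ivlProd_perturb {h : ℕ} (hh : h ≤ n) {η : ℝ} (hK : 0 ≤ K)
    (hB : ∀ i j, i ≤ j → j ≤ n → ‖ivlProd B i j‖ ≤ K * Real.exp (S j - S i))
    (hmax : ∀ i j, i ≤ j → j ≤ n → ‖ivlProd B i j‖ ≤ ‖ivlProd B 0 n‖ *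
      (Real.exp (S 0 - S i + η * i) * Real.exp (S j - S n + η * (n - j))))
    (hE : ∀ l < n, ‖B' l - B l‖ ≤ e l * Real.exp (S (l + 1) - S l))
    (he : ∀ l, 0 ≤ e l) (hsum : K * ∑ l ∈ Finset.range n, e l ≤ 1 / 2)
    (hleft : ∑ l ∈ Finset.Ico 0 h, 2 * K * e l * Real.exp (η * (l + 1)) ≤ 1 / 5)
    (hright : ∑ l ∈ Finset.Ico h n, 2 * K * e l * Real.exp (η * (n - l)) ≤ 1 / 5) :
    ‖ivlProd B 0 n‖ / 2 ≤ ‖ivlProd B' 0 n‖ := by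
  set D := ‖ivlProd B 0 n‖ with hD
  have hD0 : 0 ≤ D := norm_nonneg _
  have hB' := fun {i j : ℕ} => norm_ivlProd_perturb_le (i := i) (j := j) hK hB hE he hsum
  have split : ∀ j, h ≤ j → j ≤ n → ‖ivlProd B h j * ivlProd B' 0 h - ivlProd B 0 j‖ ≤
      D * Real.exp (S j - S n + η * (n - j)) * (1 / 5) := by
    intro j hhj hjn
    have h1 : ivlProd B h j * ivlProd B' 0 h - ivlProd B 0 j =
        ∑ l ∈ Finset.Ico 0 h, ivlProd B (l + 1) j * (B' l - B l) * ivlProd B' 0 l := by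
      rw [ivlProd_eq_add_sum B B' (Nat.zero_le h), mul_add, ivlProd_mul B (Nat.zero_le h) hhj,
        add_sub_cancel_left, Finset.mul_sum]
      refine Finset.sum_congr rfl fun l hl => ?_
      rw [← ivlProd_mul B (Finset.mem_Ico.1 hl).2 hhj]
      simp only [mul_assoc]
    rw [h1]
    have h2 : ‖∑ l ∈ Finset.Ico 0 h, ivlProd B (l + 1) j * (B' l - B l) * ivlProd B' 0 l‖ ≤
        ∑ l ∈ Finset.Ico 0 h, D * Real.exp (S j - S n + η * (n - j)) *
          (2 * K * e l * Real.exp (η * (l + 1))) := by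
      refine norm_sum_le_of_le _ fun l hl => ?_
      have hlh := (Finset.mem_Ico.1 hl).2
      have hln := hlh.trans_le hh
      refine (norm_mul_mul_le_of_le (hmax (l + 1) j (by omega) hjn) (hE l hln)
        (hB' (Nat.zero_le l) hln.le)).trans (le_of_eq ?_)
      have : Real.exp (η * (l + 1)) = Real.exp (S 0 - S (l + 1) + η * ((l + 1 : ℕ) : ℝ)) *
          Real.exp (S (l + 1) - S l) * Real.exp (S l - S 0) := by
        rw [← Real.exp_add, ← Real.exp_add]; push_cast; ring_nf
      rw [this]; ring
    rw [← Finset.mul_sum] at h2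
    exact h2.trans (by gcongr)
  have hlast : ‖ivlProd B' 0 n - ivlProd B h n * ivlProd B' 0 h‖ ≤ D * (6 / 5) * (1 / 5) := by
    have h1 : ivlProd B' 0 n - ivlProd B h n * ivlProd B' 0 h =
        ∑ l ∈ Finset.Ico h n, ivlProd B' (l + 1) n * (B' l - B l) *
          (ivlProd B h l * ivlProd B' 0 h) := by
      rw [← ivlProd_mul B' (Nat.zero_le h) hh, ivlProd_eq_add_sum' B B' hh, add_mul,
        add_sub_cancel_left, Finset.sum_mul]
      simp only [mul_assoc]
    rw [h1]
    have h2 : ‖∑ l ∈ Finset.Ico h n, ivlProd B' (l + 1) n * (B' l - B l) *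
          (ivlProd B h l * ivlProd B' 0 h)‖ ≤
        ∑ l ∈ Finset.Ico h n, D * (6 / 5) * (2 * K * e l * Real.exp (η * (n - l))) := by
      refine norm_sum_le_of_le _ fun l hl => ?_
      obtain ⟨hhl, hln⟩ := Finset.mem_Ico.1 hl
      have h3 : ‖ivlProd B h l * ivlProd B' 0 h‖ ≤
          D * (6 / 5) * Real.exp (S l - S n + η * (n - l)) := by
        have h4 := split l hhl hln.le
        have h5 := hmax 0 l (Nat.zero_le l) hln.le
        simp only [sub_self, Nat.cast_zero, mul_zero, add_zero, Real.exp_zero, one_mul] at h5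
        have h6 := norm_add_le (ivlProd B h l * ivlProd B' 0 h - ivlProd B 0 l) (ivlProd B 0 l)
        rw [sub_add_cancel] at h6
        linarith
      refine (norm_mul_mul_le_of_le (hB' hln le_rfl) (hE l hln) h3).trans (le_of_eq ?_)
      have : Real.exp (η * (n - l)) = Real.exp (S n - S (l + 1)) *
          Real.exp (S (l + 1) - S l) * Real.exp (S l - S n + η * (n - l)) := by
        rw [← Real.exp_add, ← Real.exp_add]; ring_nf
      rw [this]; ring
    rw [← Finset.mul_sum] at h2
    exact h2.trans (by gcongr)
  have hfirst := split n hh le_rfl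
  simp only [sub_self, mul_zero, add_zero, Real.exp_zero, mul_one] at hfirst
  have h7 : D ≤ ‖ivlProd B' 0 n‖ + ‖ivlProd B' 0 n - ivlProd B h n * ivlProd B' 0 h‖ +
      ‖ivlProd B h n * ivlProd B' 0 h - ivlProd B 0 n‖ := by
    have h8 := norm_sub_le (ivlProd B' 0 n) (ivlProd B' 0 n - ivlProd B h n * ivlProd B' 0 h)
    have h9 := norm_sub_le (ivlProd B h n * ivlProd B' 0 h)
      (ivlProd B h n * ivlProd B' 0 h - ivlProd B 0 n)
    rw [sub_sub_cancel] at h8 h9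
    linarith
  linarith

end Perturbation

section StableSegments

variable {X : Type*} {m : ℕ} {f : X → X} {A : X → (Em m ≃L[ℝ] Em m)} {M : ℝ}

theorem ivlProd_eq_cocycle (f : X → X) (A : X → (Em m ≃L[ℝ] Em m)) (z : X) (i n : ℕ) :
    ivlProd (fun l => (A (f^[l] z) : Em m →L[ℝ] Em m)) i (i + n) =
      cocycle f A (f^[i] z) n := by
  induction n with
  | zero => rw [add_zero, ivlProd_self]; rfl
  | succ n ih =>
    rw [← add_assoc, ivlProd_succ _ (Nat.le_add_right i n), ih, cocycle,
      ← Function.iterate_add_apply, Nat.add_comm n i]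
    rfl

theorem sum_exp_neg_le {η : ℝ} (hη : 0 < η) (s : Finset ℕ) :
    ∑ l ∈ s, Real.exp (-η * l) ≤ (1 - Real.exp (-η))⁻¹ := by
  have h1 : Real.exp (-η) < 1 := Real.exp_lt_one_iff.2 (by linarith)
  have h2 : ∀ l : ℕ, Real.exp (-η * l) = Real.exp (-η) ^ l := fun l => by
    rw [← Real.exp_nat_mul]; ring_nf
  simp only [h2]
  rw [← tsum_geometric_of_lt_one (Real.exp_pos _).le h1]
  exact (summable_geometric_of_lt_one (Real.exp_pos _).le h1).sum_le_tsum s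
    fun l _ => by positivity

variable [MetricSpace X]

/-- `y` follows the orbit segment of `z` of length `N` with an error at most
`τ e^{-λ min(l, N-l)}` at time `l`. -/
def Follows (f : X → X) (τ lam : ℝ) (N : ℕ) (z y : X) : Prop :=
  ∀ l < N, dist (f^[l] y) (f^[l] z) ≤ τ * Real.exp (-lam * ((min l (N - l) : ℕ) : ℝ))

theorem Follows.dist_le {τ lam : ℝ} {N : ℕ} {z y : X} (h : Follows f τ lam N z y)
    (hτ : 0 ≤ τ) (hlam : 0 ≤ lam) {l : ℕ} (hl : l < N) : dist (f^[l] y) (f^[l] z) ≤ τ := by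
  refine (h l hl).trans (mul_le_of_le_one_right hτ (Real.exp_le_one_iff.2 ?_))
  have := mul_nonneg hlam (Nat.cast_nonneg (α := ℝ) (min l (N - l)))
  linarith

theorem Follows.mono {τ τ' lam : ℝ} {N : ℕ} {z y : X} (h : Follows f τ lam N z y)
    (hτ : τ ≤ τ') : Follows f τ' lam N z y := fun l hl =>
  (h l hl).trans (by gcongr)

theorem Follows.sub {τ lam : ℝ} {N i j : ℕ} {z y : X} (h : Follows f τ lam N z y)
    (hτ : 0 ≤ τ) (hlam : 0 ≤ lam) (hij : i ≤ j) (hj : j ≤ N) :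
    Follows f τ lam (j - i) (f^[i] z) (f^[i] y) := by
  intro l hl
  rw [← Function.iterate_add_apply, ← Function.iterate_add_apply]
  refine (h (l + i) (by omega)).trans ?_
  have : ((min l (j - i - l) : ℕ) : ℝ) ≤ ((min (l + i) (N - (l + i)) : ℕ) : ℝ) := by
    exact_mod_cast (by omega)
  gcongr τ * Real.exp ?_
  nlinarith

/-- A deterministic selection of stable subsegments: every orbit segment contains a subsegment,
maximal for `log ‖A‖` relative to a Birkhoff sum, along which the growth of the cocycle is
inherited by all points following the segment. -/
theorem exists_stable_subsegment [NeZero m] (hM : LogBounded A M) (hA : HolderMat A)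
    {lam : ℝ} (hlam : 0 < lam) : ∃ η > 0, ∀ L : ℕ, 0 < L → ∃ τ > 0, ∀ (N : ℕ) (z : X),
      ∃ i j, i ≤ j ∧ j ≤ N ∧
        logGrowth f A z N - ∑ l ∈ Finset.range N, logGrowth f A (f^[l] z) L / L + η * N ≤
          2 * M * L + η * (j - i) ∧
        ∀ y, Follows f τ lam N z y →
          logGrowth f A (f^[i] z) (j - i) - Real.log 2 ≤ logGrowth f A (f^[i] y) (j - i) := by
  obtain ⟨α, C, hα, hC, hhol⟩ := hA
  set η := lam * α / 2 with hη
  have hη0 : 0 < η := by positivity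
  refine ⟨η, hη0, fun L hL => ?_⟩
  set K := Real.exp (2 * M * L) with hK
  have hK0 : 0 < K := Real.exp_pos _
  set G := (1 - Real.exp (-η))⁻¹ with hG
  have hG0 : 0 < G := inv_pos.2 (by linarith [Real.exp_lt_one_iff.2 (neg_lt_zero.2 hη0)])
  obtain ⟨τ, hτ, hτq⟩ : ∃ τ > 0,
      2 * K * (Real.exp M * C * τ ^ α) * Real.exp η * G ≤ 1 / 5 := by
    have h1 : Tendsto (fun τ : ℝ => 2 * K * (Real.exp M * C * τ ^ α) * Real.exp η * G)
        (𝓝[>] 0) (𝓝 0) := by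
      have h2 : Tendsto (fun τ : ℝ => τ ^ α) (𝓝[>] 0) (𝓝 0) := by
        have := (Real.continuousAt_rpow_const 0 α (Or.inr hα.le)).tendsto
        rw [Real.zero_rpow hα.ne'] at this
        exact this.mono_left nhdsWithin_le_nhds
      have h3 := (((h2.const_mul (Real.exp M * C)).const_mul (2 * K)).mul_const
        (Real.exp η)).mul_const G
      simpa using h3
    obtain ⟨τ, h4, h5⟩ := ((h1.eventually (gt_mem_nhds (by norm_num : (0 : ℝ) < 1 / 5))).and
      self_mem_nhdsWithin).exists
    exact ⟨τ, h5, h4.le⟩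
  set q := Real.exp M * C * τ ^ α with hq
  have hq0 : 0 ≤ q := by positivity
  refine ⟨τ, hτ, fun N z => ?_⟩
  set S : ℕ → ℝ := fun n => ∑ l ∈ Finset.range n, logGrowth f A (f^[l] z) L / L with hS
  have hseg : ∀ i n, logGrowth f A (f^[i] z) n ≤ S (i + n) - S i + 2 * M * L := by
    intro i n
    have h1 := logGrowth_le_sum (f := f) hM hL (f^[i] z) n
    have h2 : S (i + n) = S i + ∑ l ∈ Finset.range n, logGrowth f A (f^[l] (f^[i] z)) L / L := by
      simp only [hS, Finset.sum_range_add, ← Function.iterate_add_apply]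
      simp only [add_comm]
    linarith
  obtain ⟨⟨i, j⟩, hmem, hmax⟩ := Finset.exists_max_image
    ((Finset.range (N + 1) ×ˢ Finset.range (N + 1)).filter fun p => p.1 ≤ p.2)
    (fun p => logGrowth f A (f^[p.1] z) (p.2 - p.1) - (S p.2 - S p.1) + η * ((p.2 : ℝ) - p.1))
    ⟨(0, N), by simp⟩
  simp only [Finset.mem_filter, Finset.mem_product, Finset.mem_range] at hmem hmax
  obtain ⟨⟨-, hjN⟩, hij⟩ := hmem
  have hjN : j ≤ N := by omega
  refine ⟨i, j, hij, hjN, ?_, fun y hy => ?_⟩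
  · have h1 := hmax (0, N) ⟨⟨by simp, by simp⟩, Nat.zero_le _⟩
    have h2 := hseg i (j - i)
    rw [Nat.add_sub_cancel' hij] at h2
    have h3 : S 0 = 0 := by simp [hS]
    simp only [Function.iterate_zero, id_eq, Nat.sub_zero, h3, Nat.cast_zero, sub_zero] at h1
    linarith
  · set n := j - i with hn
    have hin : i + n = j := by omega
    have hfol := hy.sub hτ.le hlam.le hij hjN
    set z' := f^[i] z with hz'
    set y' := f^[i] y with hy'
    set S' : ℕ → ℝ := fun l => S (i + l) with hS'
    set e : ℕ → ℝ := fun l => q * Real.exp (-(2 * η) * ((min l (n - l) : ℕ) : ℝ)) with he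
    have he0 : ∀ l, 0 ≤ e l := fun l => by positivity
    have hP : ∀ a b, a ≤ b → ‖ivlProd (fun l => (A (f^[l] z') : Em m →L[ℝ] Em m)) a b‖ =
        Real.exp (logGrowth f A (f^[i + a] z) (b - a)) := by
      intro a b hab
      obtain ⟨c, rfl⟩ := Nat.exists_eq_add_of_le hab
      rw [ivlProd_eq_cocycle, exp_logGrowth hM, hz', ← Function.iterate_add_apply,
        Nat.add_sub_cancel_left, Nat.add_comm a i]
    have hleft : ∑ l ∈ Finset.Ico 0 (n / 2), 2 * K * e l * Real.exp (η * (l + 1)) ≤ 1 / 5 := by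
      refine le_trans ?_ hτq
      calc _ ≤ ∑ l ∈ Finset.Ico 0 (n / 2), 2 * K * q * Real.exp η * Real.exp (-η * l) := by
            refine Finset.sum_le_sum fun l hl => le_of_eq ?_
            have hl' := (Finset.mem_Ico.1 hl).2
            have h1 : min l (n - l) = l := by omega
            simp only [he, h1]
            have : Real.exp η * Real.exp (-η * l) =
                Real.exp (-(2 * η) * l) * Real.exp (η * (l + 1)) := by
              rw [← Real.exp_add, ← Real.exp_add]; ring_nf
            rw [mul_assoc (2 * K * q), this]; ring
        _ ≤ _ := by
            rw [← Finset.mul_sum]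
            gcongr
            exact sum_exp_neg_le hη0 _
    have hright : ∑ l ∈ Finset.Ico (n / 2) n, 2 * K * e l * Real.exp (η * (n - l)) ≤ 1 / 5 := by
      refine le_trans ?_ hτq
      calc _ ≤ ∑ l ∈ Finset.Ico (n / 2) n,
              2 * K * q * Real.exp η * Real.exp (-η * ((n - 1 - l : ℕ) : ℝ)) := by
            refine Finset.sum_le_sum fun l hl => ?_
            obtain ⟨hl1, hl2⟩ := Finset.mem_Ico.1 hl
            have h1 : ((n - 1 - l : ℕ) : ℝ) ≤ ((min l (n - l) : ℕ) : ℝ) := by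
              exact_mod_cast (by omega)
            have h2 : ((n - 1 - l : ℕ) : ℝ) = n - 1 - l := by
              rw [Nat.cast_sub (by omega), Nat.cast_sub (by omega)]; simp
            simp only [he]
            have h3 : Real.exp (-(2 * η) * ((min l (n - l) : ℕ) : ℝ)) * Real.exp (η * (n - l)) ≤
                Real.exp η * Real.exp (-η * ((n - 1 - l : ℕ) : ℝ)) := by
              rw [← Real.exp_add, ← Real.exp_add, Real.exp_le_exp]
              nlinarith
            calc _ = 2 * K * q * (Real.exp (-(2 * η) * ((min l (n - l) : ℕ) : ℝ)) *
                  Real.exp (η * (n - l))) := by ring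
              _ ≤ 2 * K * q * (Real.exp η * Real.exp (-η * ((n - 1 - l : ℕ) : ℝ))) := by gcongr
              _ = _ := by ring
        _ ≤ ∑ l ∈ Finset.range n,
              2 * K * q * Real.exp η * Real.exp (-η * ((n - 1 - l : ℕ) : ℝ)) := by
            refine Finset.sum_le_sum_of_subset_of_nonneg (fun l hl => ?_)
              fun l _ _ => by positivity
            exact Finset.mem_range.2 (Finset.mem_Ico.1 hl).2
        _ ≤ _ := by
            rw [← Finset.mul_sum,
              Finset.sum_range_reflect (fun l : ℕ => Real.exp (-η * (l : ℝ))) n]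
            gcongr
            exact sum_exp_neg_le hη0 _
    have hsum : K * ∑ l ∈ Finset.range n, e l ≤ 1 / 2 := by
      have h1 : ∑ l ∈ Finset.Ico 0 (n / 2), 2 * K * e l ≤ 1 / 5 := by
        refine le_trans (Finset.sum_le_sum fun l _ => ?_) hleft
        refine le_mul_of_one_le_right (by have := he0 l; positivity) (Real.one_le_exp ?_)
        positivity
      have h2 : ∑ l ∈ Finset.Ico (n / 2) n, 2 * K * e l ≤ 1 / 5 := by
        refine le_trans (Finset.sum_le_sum fun l hl => ?_) hright
        refine le_mul_of_one_le_right (by have := he0 l; positivity) (Real.one_le_exp ?_)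
        have : (l : ℝ) ≤ n := by exact_mod_cast (Finset.mem_Ico.1 hl).2.le
        exact mul_nonneg hη0.le (by linarith)
      rw [← Finset.mul_sum] at h1 h2
      rw [Finset.range_eq_Ico, ← Finset.sum_Ico_consecutive _ (Nat.zero_le _) (Nat.div_le_self n 2)]
      linarith
    have key := half_norm_le_norm_ivlProd_perturb
      (B := fun l => (A (f^[l] z') : Em m →L[ℝ] Em m))
      (B' := fun l => (A (f^[l] y') : Em m →L[ℝ] Em m)) (n := n) (h := n / 2) (K := K)
      (S := S') (e := e) (η := η) (Nat.div_le_self _ _) hK0.le ?_ ?_ ?_ he0 hsum hleft hright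
    · have h1 := ivlProd_eq_cocycle f A z' 0 n
      have h2 := ivlProd_eq_cocycle f A y' 0 n
      rw [zero_add] at h1 h2
      simp only [h1, h2, Function.iterate_zero, id_eq] at key
      unfold logGrowth
      rw [← Real.log_div (norm_cocycle_pos hM _ _).ne' two_ne_zero]
      exact Real.log_le_log (div_pos (norm_cocycle_pos hM _ _) two_pos) key
    · intro a b hab _
      rw [hP a b hab, hK, ← Real.exp_add, Real.exp_le_exp]
      have h1 := hseg (i + a) (b - a)
      rw [add_assoc, Nat.add_sub_cancel' hab] at h1
      simp only [hS']
      linarith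
    · intro a b hab hb
      rw [hP a b hab, hP 0 n (Nat.zero_le n), ← Real.exp_add, ← Real.exp_add, Real.exp_le_exp]
      have h1 := hmax (i + a, i + b) ⟨⟨by omega, by omega⟩, by omega⟩
      have h2 : i + b - (i + a) = b - a := by omega
      simp only [h2] at h1
      have h3 : (n : ℝ) = j - i := by rw [hn, Nat.cast_sub hij]
      simp only [hS', add_zero, hin, h3, Nat.sub_zero]
      push_cast at h1
      linarith
    · intro l hl
      have h1 : -M ≤ S' (l + 1) - S' l := by
        simp only [hS', hS, ← add_assoc, Finset.sum_range_succ]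
        have h2 := neg_le_logGrowth (f := f) hM (f^[i + l] z) L
        have h3 : (0 : ℝ) < L := by exact_mod_cast hL
        have h4 : -M ≤ logGrowth f A (f^[i + l] z) L / L := by
          rw [le_div_iff₀ h3]; linarith
        linarith
      calc _ ≤ C * dist (f^[l] y') (f^[l] z') ^ α := hhol _ _
        _ ≤ C * (τ * Real.exp (-lam * ((min l (n - l) : ℕ) : ℝ))) ^ α := by
            gcongr
            exact hfol l hl
        _ = e l * Real.exp (-M) := by
            rw [Real.mul_rpow hτ.le (Real.exp_pos _).le, ← Real.exp_mul]
            simp only [he, hq]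
            have : -lam * ((min l (n - l) : ℕ) : ℝ) * α =
              -(2 * η) * ((min l (n - l) : ℕ) : ℝ) := by rw [hη]; ring
            rw [this, Real.exp_neg M]
            field_simp
        _ ≤ _ := by
            have := he0 l
            gcongr

end StableSegments

section GrowthSegments

variable {X : Type*} {m : ℕ} {f : X → X} {A : X → (Em m ≃L[ℝ] Em m)} {M : ℝ}

theorem integral_sum_iterate [MeasurableSpace X] {μ : Measure X} (hμ : MeasurePreserving f μ μ)
    {φ : X → ℝ} (hφ : Integrable φ μ) (N : ℕ) :
    Integrable (fun x => ∑ l ∈ Finset.range N, φ (f^[l] x)) μ ∧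
      ∫ x, ∑ l ∈ Finset.range N, φ (f^[l] x) ∂μ = N * ∫ x, φ x ∂μ := by
  have h_int : ∀ l, Integrable (fun x => φ (f^[l] x)) μ := fun l =>
    (hμ.iterate l).integrable_comp_of_integrable hφ
  refine ⟨integrable_finsetSum _ fun l _ => h_int l, ?_⟩
  rw [integral_finsetSum _ fun l _ => h_int l]
  have : ∀ l, ∫ x, φ (f^[l] x) ∂μ = ∫ x, φ x ∂μ := fun l => by
    have h := (hμ.iterate l)
    conv_rhs => rw [← h.map_eq]
    exact (integral_map h.measurable.aemeasurable
      (by rw [h.map_eq]; exact hφ.aestronglyMeasurable)).symm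
  simp [this]

variable [MetricSpace X] [CompactSpace X] [MeasurableSpace X] [BorelSpace X]

/-- Orbit segments of definite `μ`-measure whose growth rate, nearly `χ_max(A,μ)`, is inherited
by all points following them exponentially well. -/
theorem exists_high_growth_set [NeZero m] (hf : Continuous f) (hA : HolderMat A) {lam : ℝ}
    (hlam : 0 < lam) (μ : Measure X) [IsProbabilityMeasure μ] (hμ : MeasurePreserving f μ μ)
    {χ₁ : ℝ} (hχ : χ₁ < mle f A μ) :
    ∃ τ > 0, ∃ c > 0, ∃ N₀ : ℕ, ∀ N ≥ N₀, ∃ H : Set X, MeasurableSet H ∧ c ≤ μ.real H ∧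
      ∀ z ∈ H, ∃ j ≤ N, N ≤ 2 * j ∧ ∀ y, Follows f τ lam N z y → χ₁ * j ≤ logGrowth f A y j := by
  have hAc := hA.continuous
  obtain ⟨M, hM1, hM⟩ := exists_logBounded hAc
  obtain ⟨η, hη, hstable⟩ := exists_stable_subsegment (f := f) hM hA hlam
  set χ := mle f A μ with hχdef
  have hχM : -M ≤ χ := neg_le_mle hM hf hAc μ
  set ε := (χ - χ₁) / 4 with hε
  have hε0 : 0 < ε := by simp only [hε]; linarith
  set c := ε / (2 * M + ε) with hc
  have hc0 : 0 < c := by positivity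
  obtain ⟨κ, hκ0, hκ1, hκ⟩ : ∃ κ > 0, κ ≤ 1 / 2 ∧ (2 * M + |χ₁|) * κ ≤ ε := by
    have hpos : 0 < 2 * M + |χ₁| := by positivity
    refine ⟨min (1 / 2) (ε / (2 * M + |χ₁|)), by positivity, min_le_left _ _, ?_⟩
    calc _ ≤ (2 * M + |χ₁|) * (ε / (2 * M + |χ₁|)) := by gcongr; exact min_le_right _ _
      _ = ε := by field_simp
  set ε₃ := κ * η / 2 with hε₃
  have hε₃0 : 0 < ε₃ := by positivity
  set ε₂ := c * ε₃ / 4 with hε₂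
  have hε₂0 : 0 < ε₂ := by positivity
  obtain ⟨L, hL, hLint⟩ := exists_integral_lt_of_mle_lt
    (show mle f A μ < χ + ε₂ by linarith)
  obtain ⟨τ, hτ, hseg⟩ := hstable L hL
  set K := 2 * M * L with hK
  have hK0 : 0 ≤ K := by positivity
  obtain ⟨N₀, hN₀⟩ := exists_nat_ge (K / ε₂ + K / ε₃ + Real.log 2 / ε + 1)
  refine ⟨τ, hτ, c / 2, by positivity, N₀, fun N hN => ?_⟩
  have hlog2 : 0 ≤ Real.log 2 := Real.log_nonneg (by norm_num)
  have hNr : K / ε₂ + K / ε₃ + Real.log 2 / ε + 1 ≤ N := hN₀.trans (by exact_mod_cast hN)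
  have hd1 : 0 ≤ K / ε₂ := by positivity
  have hd2 : 0 ≤ K / ε₃ := by positivity
  have hd3 : 0 ≤ Real.log 2 / ε := by positivity
  have hN1 : K ≤ ε₂ * N := by
    have : K / ε₂ ≤ N := by linarith
    rwa [div_le_iff₀' hε₂0] at this
  have hN2 : K ≤ ε₃ * N := by
    have : K / ε₃ ≤ N := by linarith
    rwa [div_le_iff₀' hε₃0] at this
  have hN3 : Real.log 2 ≤ ε * N := by
    have : Real.log 2 / ε ≤ N := by linarith
    rwa [div_le_iff₀' hε0] at this
  have hNpos : (0 : ℝ) < N := by linarith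
  have hcont := fun n => continuous_logGrowth (f := f) hM hf hAc n
  set φ : X → ℝ := fun x => logGrowth f A x L / L with hφ
  have hφc : Continuous φ := (hcont L).div_const _
  have hφi : Integrable φ μ := (integrable_logGrowth hM hf hAc μ L).div_const _
  obtain ⟨hSi, hSint⟩ := integral_sum_iterate hμ hφi N
  have hSc : Continuous fun x => ∑ l ∈ Finset.range N, φ (f^[l] x) :=
    continuous_finsetSum _ fun l _ => hφc.comp (hf.iterate l)
  set U : Set X := {z | (χ - ε) * N ≤ logGrowth f A z N} with hU
  have hUm : MeasurableSet U := measurableSet_le measurable_const (hcont N).measurable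
  set g : X → ℝ := fun z => ∑ l ∈ Finset.range N, φ (f^[l] z) + K - logGrowth f A z N with hg
  have hai := integrable_logGrowth (f := f) hM hf hAc μ N
  have hgi : Integrable g μ := (hSi.add (integrable_const K)).sub hai
  set V : Set X := {z | ε₃ * N ≤ g z} with hV
  have hVm : MeasurableSet V :=
    measurableSet_le measurable_const ((hSc.add continuous_const).sub (hcont N)).measurable
  have hage := mle_mul_le_integral (f := f) hM hf hAc μ N
  have hUmeas : c ≤ μ.real U := by
    have h1 : ∫ x, logGrowth f A x N ∂μ ≤
        ∫ x, ((χ - ε) * N + U.indicator (fun _ => (2 * M + ε) * N) x) ∂μ := by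
      refine integral_mono hai
        ((integrable_const _).add ((integrable_const _).indicator hUm)) fun x => ?_
      by_cases hx : x ∈ U
      · simp only [indicator_of_mem hx]
        have := logGrowth_le (f := f) hM x N
        nlinarith
      · simp only [indicator_of_notMem hx, add_zero]
        exact (not_le.1 hx).le
    rw [integral_add (integrable_const _) ((integrable_const _).indicator hUm),
      integral_indicator_const _ hUm] at h1
    simp only [integral_const, probReal_univ, smul_eq_mul] at h1
    have h2 : ε * N ≤ μ.real U * (2 * M + ε) * N := by linarith
    have h3 := le_of_mul_le_mul_right h2 hNpos
    rw [hc, div_le_iff₀ (by positivity)]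
    exact h3
  have hVmeas : μ.real V ≤ c / 2 := by
    have h1 := mul_meas_ge_le_integral_of_nonneg (μ := μ) (f := g)
      (Eventually.of_forall fun x => by
        have := logGrowth_le_sum (f := f) hM hL x N
        show 0 ≤ g x
        simp only [hg]
        linarith) hgi (ε₃ * N)
    have h2 : ∫ x, g x ∂μ ≤ 2 * ε₂ * N := by
      have h3 : ∫ x, g x ∂μ = N * ∫ x, φ x ∂μ + K - ∫ x, logGrowth f A x N ∂μ := by
        have hadd : Integrable (fun z => ∑ l ∈ Finset.range N, φ (f^[l] z) + K) μ :=
          hSi.add (integrable_const K)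
        simp only [hg]
        rw [integral_sub hadd hai, integral_add hSi (integrable_const K), hSint]
        simp
      have h4 : N * ∫ x, φ x ∂μ ≤ N * (χ + ε₂) := by gcongr
      rw [h3]
      linarith
    have h5 : ε₃ * N * μ.real V ≤ 2 * ε₂ * N := h1.trans h2
    have h6 : μ.real V * (ε₃ * N) ≤ c / 2 * (ε₃ * N) := by
      rw [hε₂] at h5; linarith
    exact le_of_mul_le_mul_right h6 (by positivity)
  refine ⟨U \ V, hUm.diff hVm, ?_, fun z hz => ?_⟩
  · have h1 : μ.real U ≤ μ.real (U \ V) + μ.real V :=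
      (measureReal_mono (by rw [Set.sdiff_union_self]; exact subset_union_left)).trans
        (measureReal_union_le _ _)
    linarith
  · obtain ⟨i, j, hij, hjN, hmax, hfol⟩ := hseg N z
    have hzU : (χ - ε) * N ≤ logGrowth f A z N := hz.1
    have hzV : g z < ε₃ * N := not_le.1 hz.2
    simp only [hg] at hzV
    have hij' : (i : ℝ) ≤ j := by exact_mod_cast hij
    have hjN' : (j : ℝ) ≤ N := by exact_mod_cast hjN
    have hi0 : (0 : ℝ) ≤ i := Nat.cast_nonneg i
    have hκN : N - ((j : ℝ) - i) ≤ κ * N := by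
      have h1 : η * (N - ((j : ℝ) - i)) ≤ η * (κ * N) := by
        have h2 : η * (κ * N) = 2 * ε₃ * N := by rw [hε₃]; ring
        rw [h2]
        linarith
      exact le_of_mul_le_mul_left h1 hη
    refine ⟨j, hjN, ?_, fun y hy => ?_⟩
    · have : (N : ℝ) ≤ 2 * j := by nlinarith
      exact_mod_cast this
    · have h1 := hfol y hy
      have h2 : logGrowth f A z N ≤ M * i + logGrowth f A (f^[i] z) (j - i) + M * (N - j) := by
        have h3 := logGrowth_add_le (f := f) hM z i (N - i)
        have h4 := logGrowth_add_le (f := f) hM (f^[i] z) (j - i) (N - j)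
        have h5 := logGrowth_le (f := f) hM z i
        have h6 := logGrowth_le (f := f) hM (f^[j - i] (f^[i] z)) (N - j)
        rw [Nat.add_sub_cancel' (hij.trans hjN)] at h3
        rw [show j - i + (N - j) = N - i by omega] at h4
        rw [Nat.cast_sub hjN] at h6
        linarith
      have h7 := logGrowth_shift_le (f := f) hM y i (j - i)
      rw [Nat.add_sub_cancel' hij] at h7
      have h8 : M * (2 * i + (N - j)) ≤ M * (2 * (κ * N)) := by
        gcongr
        linarith
      have h9 : χ₁ * j ≤ χ₁ * N + |χ₁| * (κ * N) := by
        have h10 : -|χ₁| ≤ χ₁ := neg_abs_le _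
        have h11 : (N : ℝ) - j ≤ κ * N := by linarith
        have h12 : (0 : ℝ) ≤ N - j := by linarith
        have h13 : 0 ≤ |χ₁| := abs_nonneg _
        have h17 := mul_nonneg h13 (sub_nonneg.2 h11)
        have h18 := mul_nonneg (by linarith : 0 ≤ |χ₁| + χ₁) h12
        clear * - h17 h18
        linarith
      have h14 : (2 * M + |χ₁|) * κ * N ≤ ε * N := by gcongr
      have h15 : χ = χ₁ + 4 * ε := by rw [hε]; ring
      have h16 : χ * N = χ₁ * N + 4 * ε * N := by rw [h15]; ring
      have h19 : 0 ≤ ε * N := by positivity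
      clear * - h1 h2 h7 h8 h9 h14 h16 h19 hzU hN3
      linarith

/-- Orbit segments along which, for all nearby points, the growth rate is at most slightly
larger than `χ_max(A,ν)`. -/
theorem exists_low_growth_point [NeZero m] (hf : Continuous f) (hA : HolderMat A)
    (ν : Measure X) [IsProbabilityMeasure ν] (hν : MeasurePreserving f ν ν)
    {χ₂ : ℝ} (hχ : mle f A ν < χ₂) :
    ∃ τ > 0, ∃ N₀ : ℕ, ∀ N ≥ N₀, ∃ z : X, ∀ y, (∀ l < N, dist (f^[l] y) (f^[l] z) ≤ τ) →
      logGrowth f A y N ≤ χ₂ * N := by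
  have hAc := hA.continuous
  obtain ⟨M, hM1, hM⟩ := exists_logBounded hAc
  obtain ⟨ρ, hρ1, hρ2⟩ := exists_between hχ
  obtain ⟨L, hL, hLint⟩ := exists_integral_lt_of_mle_lt hρ1
  set φ : X → ℝ := fun x => logGrowth f A x L / L with hφ
  have hφc : Continuous φ := (continuous_logGrowth hM hf hAc L).div_const _
  have hφi : Integrable φ ν := (integrable_logGrowth hM hf hAc ν L).div_const _
  set ε := (χ₂ - ρ) / 2 with hε
  have hε0 : 0 < ε := by simp only [hε]; linarith
  obtain ⟨τ, hτ, hunif⟩ := Metric.uniformContinuous_iff.1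
    (CompactSpace.uniformContinuous_of_continuous hφc) ε hε0
  obtain ⟨N₀, hN₀⟩ := exists_nat_ge (2 * M * L / ε)
  refine ⟨τ / 2, by positivity, N₀, fun N hN => ?_⟩
  obtain ⟨hSi, hSint⟩ := integral_sum_iterate hν hφi N
  obtain ⟨z, hz⟩ := exists_le_integral hSi
  refine ⟨z, fun y hy => ?_⟩
  have h1 := logGrowth_le_sum (f := f) hM hL y N
  have h2 : ∑ l ∈ Finset.range N, φ (f^[l] y) ≤ ∑ l ∈ Finset.range N, (φ (f^[l] z) + ε) := by
    refine Finset.sum_le_sum fun l hl => ?_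
    have := hunif ((hy l (Finset.mem_range.1 hl)).trans_lt (half_lt_self hτ))
    rw [Real.dist_eq] at this
    linarith [(abs_lt.1 this).2]
  rw [Finset.sum_add_distrib] at h2
  simp only [Finset.sum_const, Finset.card_range, nsmul_eq_mul] at h2
  rw [hSint] at hz
  have h3 : N * ∫ x, φ x ∂ν ≤ N * ρ := by gcongr
  have h4 : 2 * M * L ≤ ε * N := by
    rw [← div_le_iff₀' hε0]
    exact hN₀.trans (by exact_mod_cast hN)
  have h5 : χ₂ * N = N * ρ + 2 * (ε * N) := by rw [hε]; ring
  linarith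

end GrowthSegments

section Irregular

variable {X : Type*} {m : ℕ} {f : X → X} {A : X → (Em m ≃L[ℝ] Em m)}

/-- A criterion for irregularity: growth of rate at least `χ₁` at arbitrarily large times, and
additional growth of rate at most `χ₂ < χ₁` over long time intervals. -/
theorem mem_MLIrr_of_growth {x : X} {χ₁ χ₂ θ : ℝ} (hχ : χ₂ < χ₁) (hθ : 0 < θ)
    (hhigh : ∀ N : ℕ, ∃ t ≥ N, χ₁ * t ≤ logGrowth f A x t)
    (hlow : ∀ N : ℕ, ∃ T ≥ N, ∃ n : ℕ, θ * T ≤ n ∧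
      logGrowth f A x (T + n) ≤ logGrowth f A x T + χ₂ * n) :
    x ∈ MLIrr f A := by
  rintro ⟨c, hc⟩
  have hc' : Tendsto (fun n : ℕ => logGrowth f A x n / n) atTop (𝓝 c) := hc
  have hc1 : χ₁ ≤ c := by
    refine ge_of_tendsto_of_frequently hc' (frequently_atTop.2 fun N => ?_)
    obtain ⟨t, ht, h⟩ := hhigh (N + 1)
    refine ⟨t, by omega, ?_⟩
    have ht0 : (0 : ℝ) < t := by exact_mod_cast (by omega)
    rwa [le_div_iff₀ ht0]
  set ε := (χ₁ - χ₂) / (2 * (2 / θ + 1)) with hε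
  have hε0 : 0 < ε := div_pos (by linarith) (by positivity)
  obtain ⟨N, hN⟩ := Metric.tendsto_atTop.1 hc' ε hε0
  have hbd : ∀ n : ℕ, N < n → |logGrowth f A x n - c * n| ≤ ε * n := by
    intro n hn
    have hn0 : (0 : ℝ) < n := by exact_mod_cast (by omega)
    have h1 := (hN n hn.le).le
    rw [Real.dist_eq] at h1
    have h2 : logGrowth f A x n - c * n = (logGrowth f A x n / n - c) * n := by field_simp
    rw [h2, abs_mul, abs_of_pos hn0]
    gcongr
  obtain ⟨T, hT, n, hn, hgrow⟩ := hlow (N + 1)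
  have h1 := abs_le.1 (hbd T (by omega))
  have h2 := abs_le.1 (hbd (T + n) (by omega))
  have hT0 : (0 : ℝ) < T := by exact_mod_cast (by omega)
  have hn0 : (0 : ℝ) < n := lt_of_lt_of_le (by positivity) hn
  push_cast at h2
  have h3 : (c - χ₂) * n ≤ ε * (2 * T + n) := by nlinarith
  have h4 : (T : ℝ) ≤ n / θ := by rw [le_div_iff₀ hθ]; linarith
  have h5 : ε * (2 * T + n) ≤ ε * (2 * (n / θ) + n) := by gcongr
  have h6 : ε * (2 * (n / θ) + n) = (χ₁ - χ₂) / 2 * n := by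
    rw [hε]; field_simp
  have h7 : (c - χ₂) * n ≤ (χ₁ - χ₂) / 2 * n := by linarith
  have h8 := le_of_mul_le_mul_right h7 hn0
  linarith

end Irregular

section Gluing

variable {X : Type*} [MetricSpace X]

theorem TopMixingOn.exists_uniform_gap [CompactSpace X] {f : X → X} (hmix : TopMixingOn f univ)
    {δ : ℝ} (hδ : 0 < δ) :
    ∃ g : ℕ, 1 ≤ g ∧ ∀ x y : X, ∃ z, dist x z < δ ∧ dist (f^[g] z) y < δ := by
  obtain ⟨t, -, ht⟩ := isCompact_univ.elim_nhds_subcover (fun x : X => Metric.ball x (δ / 2))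
    fun x _ => Metric.ball_mem_nhds x (half_pos hδ)
  have hN : ∀ a b : X, ∃ N : ℕ, ∀ n ≥ N,
      ∃ z, dist z a < δ / 2 ∧ dist (f^[n] z) b < δ / 2 := fun a b => by
    obtain ⟨N, hN⟩ := hmix (Metric.ball a (δ / 2)) (Metric.ball b (δ / 2)) Metric.isOpen_ball
      Metric.isOpen_ball ⟨a, by simp [hδ]⟩ ⟨b, by simp [hδ]⟩
    refine ⟨N, fun n hn => ?_⟩
    obtain ⟨_, ⟨z, hz, rfl⟩, hb⟩ := hN n hn
    exact ⟨z, hz.1, hb.1⟩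
  choose N hN using hN
  refine ⟨t.sup (fun a => t.sup (N a)) + 1, by omega, fun x y => ?_⟩
  have hcov : ∀ x : X, ∃ a ∈ t, dist x a < δ / 2 := fun x => by
    simpa using ht (mem_univ x)
  obtain ⟨a, ha, hxa⟩ := hcov x
  obtain ⟨b, hb, hyb⟩ := hcov y
  have h1 : N a b ≤ t.sup (N a) := Finset.le_sup hb
  have h2 : t.sup (N a) ≤ t.sup (fun a => t.sup (N a)) :=
    Finset.le_sup (f := fun a => t.sup (N a)) ha
  obtain ⟨z, hza, hzb⟩ := hN a b (t.sup (fun a => t.sup (N a)) + 1) (by omega)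
  refine ⟨z, ?_, ?_⟩
  · linarith [dist_triangle_right x z a]
  · linarith [dist_triangle_right (f^[t.sup (fun a => t.sup (N a)) + 1] z) y b]

theorem exists_gluing [CompactSpace X] {f : X ≃ X} (hmix : TopMixingOn (⇑f) univ) {lam : ℝ}
    (hs : ExpShadowingWith f lam) {τ : ℝ} (hτ : 0 < τ) :
    ∃ g : ℕ, ∀ (x : ℕ → X) (n T : ℕ → ℕ), (∀ k, 1 ≤ n k) → T 0 = 0 →
      (∀ k, T (k + 1) = T k + n k + g) →
      ∃ p, ∀ k, Follows (⇑f) τ lam (n k) (x k) ((⇑f)^[T k] p) := by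
  obtain ⟨δ, hδ, hshad⟩ := hs τ hτ
  obtain ⟨g, hg, hgap⟩ := hmix.exists_uniform_gap hδ
  refine ⟨g, fun x n T hn hT0 hT => ?_⟩
  choose z hz1 hz2 using fun k => hgap ((⇑f)^[n k] (x k)) (x (k + 1))
  let xs : ℤ → X := fun i => match i with
    | Int.ofNat j => if j % 2 = 0 then x (j / 2) else z (j / 2)
    | Int.negSucc j => (f ^ (Int.negSucc j)) (x 0)
  let ns : ℤ → ℕ := fun i => match i with
    | Int.ofNat j => if j % 2 = 0 then n (j / 2) else g
    | Int.negSucc _ => 1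
  have xs_even : ∀ k : ℕ, xs ((2 * k : ℕ) : ℤ) = x k := fun k => by
    show (if (2 * k) % 2 = 0 then x (2 * k / 2) else z (2 * k / 2)) = x k
    simp
  have xs_odd : ∀ k : ℕ, xs ((2 * k + 1 : ℕ) : ℤ) = z k := fun k => by
    show (if (2 * k + 1) % 2 = 0 then x ((2 * k + 1) / 2) else z ((2 * k + 1) / 2)) = z k
    rw [if_neg (by omega), show (2 * k + 1) / 2 = k by omega]
  have ns_even : ∀ k : ℕ, ns ((2 * k : ℕ) : ℤ) = n k := fun k => by
    show (if (2 * k) % 2 = 0 then n (2 * k / 2) else g) = n k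
    simp
  have ns_odd : ∀ k : ℕ, ns ((2 * k + 1 : ℕ) : ℤ) = g := fun k => by
    show (if (2 * k + 1) % 2 = 0 then n ((2 * k + 1) / 2) else g) = g
    rw [if_neg (by omega)]
  have hcsum : ∀ k : ℕ, csum ns ((2 * k : ℕ) : ℤ) = T k := by
    intro k
    rw [csum, if_pos (by positivity), Int.toNat_natCast]
    induction k with
    | zero => simp [hT0]
    | succ k ih =>
      rw [show 2 * (k + 1) = 2 * k + 1 + 1 by ring, Finset.sum_range_succ, Finset.sum_range_succ,
        ih, ns_even, ns_odd, hT]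
      push_cast
      ring
  have hpo : IsPseudoOrbit (⇑f) δ xs ns := by
    refine ⟨fun i => ?_, fun i => ?_⟩
    · cases i with
      | ofNat j =>
        show 1 ≤ if j % 2 = 0 then n (j / 2) else g
        split_ifs
        exacts [hn _, hg]
      | negSucc j => exact le_rfl
    · cases i with
      | ofNat j =>
        obtain ⟨k, rfl | rfl⟩ := j.even_or_odd'
        · have := hz1 k
          show dist ((⇑f)^[ns ((2 * k : ℕ) : ℤ)] (xs ((2 * k : ℕ) : ℤ))) (xs ((2 * k + 1 : ℕ) : ℤ)) < δ
          rwa [ns_even, xs_even, xs_odd]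
        · have := hz2 k
          show dist ((⇑f)^[ns ((2 * k + 1 : ℕ) : ℤ)] (xs ((2 * k + 1 : ℕ) : ℤ)))
            (xs ((2 * (k + 1) : ℕ) : ℤ)) < δ
          rwa [ns_odd, xs_odd, xs_even]
      | negSucc j =>
        have h : ∀ i : ℤ, f ((f ^ i) (x 0)) = (f ^ (i + 1)) (x 0) := fun i => by
          rw [add_comm, zpow_add, zpow_one, Equiv.Perm.mul_apply]
        have h1 : (⇑f)^[ns (Int.negSucc j)] (xs (Int.negSucc j)) = xs (Int.negSucc j + 1) := by
          show f ((f ^ (Int.negSucc j)) (x 0)) = _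
          rw [h]
          cases j with
          | zero => show (f ^ (0 : ℤ)) (x 0) = if 0 % 2 = 0 then x (0 / 2) else z (0 / 2)
                    simp
          | succ j => rfl
        rw [h1, dist_self]
        exact hδ
  obtain ⟨p, hp⟩ := hshad xs ns hpo
  refine ⟨p, fun k l hl => ?_⟩
  have h := hp ((2 * k : ℕ) : ℤ) l (by rwa [ns_even])
  rw [hcsum, xs_even, ns_even] at h
  have h2 : (f ^ ((T k : ℤ) + (l : ℤ)) : X ≃ X) p = (⇑f)^[l] ((⇑f)^[T k] p) := by
    rw [← Function.iterate_add_apply, ← Nat.cast_add, zpow_natCast, Nat.add_comm,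
      Equiv.Perm.iterate_eq_pow]
  rw [h2] at h
  exact h.le

/-- Block lengths and starting times can be chosen successively. -/
theorem exists_schedule (g : ℕ) {Q : ℕ → ℕ → ℕ → Prop} (hQ : ∀ k T, ∃ n, 1 ≤ n ∧ Q k T n) :
    ∃ n T : ℕ → ℕ, T 0 = 0 ∧ (∀ k, T (k + 1) = T k + n k + g) ∧ (∀ k, 1 ≤ n k) ∧
      ∀ k, Q k (T k) (n k) := by
  choose N hN1 hN using hQ
  let T : ℕ → ℕ := fun k => Nat.rec 0 (fun k T => T + N k T + g) k
  exact ⟨fun k => N k (T k), T, rfl, fun k => rfl, fun k => hN1 _ _, fun k => hN _ _⟩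

theorem le_of_schedule {n T : ℕ → ℕ} {g : ℕ} (hT : ∀ k, T (k + 1) = T k + n k + g)
    (hn : ∀ k, 1 ≤ n k) (k : ℕ) : k ≤ T k := by
  induction k with
  | zero => simp
  | succ k ih => have := hT k; have := hn k; omega

end Gluing

section Coding

variable {X α : Type*}

/-- The sum of `F` over all words of length `n`. -/
def sumW [Fintype α] : ℕ → (List α → ℝ) → ℝ
  | 0, F => F []
  | n + 1, F => ∑ a, sumW n fun w => F (a :: w)

/-- The itinerary of length `n` of `x` with respect to the partition `P`. -/
def itin (f : X → X) (P : X → α) : ℕ → X → List α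
  | 0, _ => []
  | n + 1, x => P x :: itin f P n (f x)

theorem itin_take (f : X → X) (P : X → α) {n N : ℕ} (h : n ≤ N) (x : X) :
    (itin f P N x).take n = itin f P n x := by
  induction n generalizing N x with
  | zero => simp [itin]
  | succ n ih =>
    obtain ⟨N, rfl⟩ : ∃ K, N = K + 1 := ⟨N - 1, by omega⟩
    simp [itin, ih (show n ≤ N by omega)]

theorem itin_drop (f : X → X) (P : X → α) (n N : ℕ) (x : X) :
    (itin f P N x).drop n = itin f P (N - n) (f^[n] x) := by
  induction n generalizing N x with
  | zero => simp
  | succ n ih =>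
    cases N with
    | zero => simp [itin]
    | succ N => simp [itin, ih]

theorem itin_eq_ofFn (f : X → X) (P : X → α) (n : ℕ) (x : X) :
    itin f P n x = List.ofFn fun i : Fin n => P (f^[i] x) := by
  induction n generalizing x with
  | zero => simp [itin]
  | succ n ih => simp [itin, ih, List.ofFn_succ]

section sumW

variable [Fintype α]

theorem sumW_eq_sum_ofFn (n : ℕ) (F : List α → ℝ) :
    sumW n F = ∑ c : Fin n → α, F (List.ofFn c) := by
  induction n generalizing F with
  | zero => simp [sumW]
  | succ n ih =>
    rw [← (Fin.consEquiv fun _ : Fin (n + 1) => α).sum_comp, Fintype.sum_prod_type]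
    simp [sumW, ih, Fin.consEquiv, List.ofFn_succ]

theorem sumW_add (n : ℕ) (F G : List α → ℝ) :
    sumW n (fun w => F w + G w) = sumW n F + sumW n G := by
  simp [sumW_eq_sum_ofFn, Finset.sum_add_distrib]

theorem sumW_mul_left (n : ℕ) (c : ℝ) (F : List α → ℝ) :
    sumW n (fun w => c * F w) = c * sumW n F := by
  simp [sumW_eq_sum_ofFn, Finset.mul_sum]

theorem sumW_sum {ι : Type*} (s : Finset ι) (n : ℕ) (F : ι → List α → ℝ) :
    sumW n (fun w => ∑ i ∈ s, F i w) = ∑ i ∈ s, sumW n (F i) := by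
  simp only [sumW_eq_sum_ofFn]
  exact Finset.sum_comm

theorem sumW_nonneg {n : ℕ} {F : List α → ℝ} (h : ∀ w, 0 ≤ F w) : 0 ≤ sumW n F := by
  rw [sumW_eq_sum_ofFn]
  exact Finset.sum_nonneg fun _ _ => h _

theorem sumW_take_mul_drop (n m : ℕ) (F G : List α → ℝ) :
    sumW (n + m) (fun w => F (w.take n) * G (w.drop n)) = sumW n F * sumW m G := by
  induction n generalizing F with
  | zero => simp [sumW, sumW_mul_left]
  | succ n ih =>
    rw [show n + 1 + m = n + m + 1 by ring]
    simp only [sumW, List.take_succ_cons, List.drop_succ_cons, Finset.sum_mul]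
    exact Finset.sum_congr rfl fun a _ => ih fun w => F (a :: w)

theorem sumW_tail (n : ℕ) (F : List α → ℝ) :
    sumW (n + 1) (fun w => F w.tail) = Fintype.card α * sumW n F := by
  simp [sumW]

end sumW

/-- Itineraries can be coded by concatenating words from the dictionaries `dict n`: this yields a
subprobability on words of length `N` giving itineraries a definite weight. -/
theorem exists_coding [Fintype α] {f : X → X} {P : X → α} {dict : ℕ → List α → ℝ}
    (hdict0 : ∀ n w, 0 ≤ dict n w) (hdict : ∀ n, sumW n (dict n) ≤ 1) {L M : ℕ} (hL : 1 ≤ L)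
    {γ : ℝ} (hγ : ∑ n ∈ Finset.Icc L M, Real.exp (-γ * n) ≤ 1 / 2)
    {B : Set X} {φ : X → ℝ} (hB : ∀ x ∈ B, ∃ n ∈ Finset.Icc L M,
      Real.exp (-∑ i ∈ Finset.range n, φ (f^[i] x)) ≤ dict n (itin f P n x))
    {b : ℝ} (hb0 : 0 ≤ b) (hb : Real.exp b = 2 * Fintype.card α) (hφ : ∀ x, 0 ≤ γ + φ x) (N : ℕ) :
    ∃ q : List α → ℝ, (∀ w, 0 ≤ q w) ∧ sumW N q ≤ 1 ∧ ∀ x,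
      Real.exp (-(∑ i ∈ Finset.range N, (γ + φ (f^[i] x) + Bᶜ.indicator (fun _ => b) (f^[i] x)) +
        b * (min N M : ℕ))) ≤ q (itin f P N x) := by
  have hind : ∀ x, 0 ≤ Bᶜ.indicator (fun _ => b) x := fun x => indicator_nonneg (fun _ _ => hb0) x
  induction N using Nat.strong_induction_on with
  | _ N ih =>
  cases N with
  | zero => exact ⟨fun _ => 1, fun _ => zero_le_one, by simp [sumW], fun x => by simp⟩
  | succ N =>
  choose! q hq0 hq1 hq2 using ih
  set I := (Finset.Icc L M).filter (· ≤ N + 1) with hI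
  have hIpos : ∀ n ∈ I, N + 1 - n < N + 1 := fun n hn => by
    simp only [hI, Finset.mem_filter, Finset.mem_Icc] at hn
    omega
  refine ⟨fun w => Real.exp (-b) * q N w.tail +
    ∑ n ∈ I, Real.exp (-γ * n) * (dict n (w.take n) * q (N + 1 - n) (w.drop n)),
    fun w => ?_, ?_, fun x => ?_⟩
  · refine add_nonneg (mul_nonneg (Real.exp_pos _).le (hq0 N (by omega) _))
      (Finset.sum_nonneg fun n hn => mul_nonneg (Real.exp_pos _).le
        (mul_nonneg (hdict0 _ _) (hq0 _ (hIpos n hn) _)))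
  · rw [sumW_add, sumW_sum, sumW_tail N fun w => Real.exp (-b) * q N w, sumW_mul_left]
    have h1 : (Fintype.card α : ℝ) * (Real.exp (-b) * sumW N (q N)) ≤ 1 / 2 := by
      have h2 : Real.exp (-b) * (2 * Fintype.card α) = 1 := by
        rw [← hb, ← Real.exp_add]; simp
      have h3 := hq1 N (by omega)
      have h4 : (Fintype.card α : ℝ) * (Real.exp (-b) * sumW N (q N)) = 1 / 2 * sumW N (q N) := by
        rw [← h2]; ring
      rw [h4]; linarith
    have h5 : ∑ n ∈ I, sumW (N + 1)
        (fun w => Real.exp (-γ * n) * (dict n (w.take n) * q (N + 1 - n) (w.drop n))) ≤ 1 / 2 := by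
      refine le_trans (Finset.sum_le_sum (g := fun n : ℕ => Real.exp (-γ * n)) fun n hn => ?_)
        ((Finset.sum_le_sum_of_subset_of_nonneg (Finset.filter_subset _ _)
          fun _ _ _ => (Real.exp_pos _).le).trans hγ)
      have hnN : n + (N + 1 - n) = N + 1 := by
        have := (Finset.mem_filter.1 hn).2; omega
      rw [sumW_mul_left]
      have h6 := sumW_take_mul_drop n (N + 1 - n) (dict n) (q (N + 1 - n))
      rw [hnN] at h6
      rw [h6]
      exact mul_le_of_le_one_right (Real.exp_pos _).le (mul_le_one₀ (hdict n)
        (sumW_nonneg (hq0 _ (hIpos n hn))) (hq1 _ (hIpos n hn)))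
    linarith
  · have hterm : ∀ n ∈ I, 0 ≤ Real.exp (-γ * n) * (dict n ((itin f P (N + 1) x).take n) *
        q (N + 1 - n) ((itin f P (N + 1) x).drop n)) := fun n hn =>
      mul_nonneg (Real.exp_pos _).le (mul_nonneg (hdict0 _ _) (hq0 _ (hIpos n hn) _))
    have hfirst : 0 ≤ Real.exp (-b) * q N (itin f P (N + 1) x).tail :=
      mul_nonneg (Real.exp_pos _).le (hq0 N (by omega) _)
    set ψ : X → ℝ := fun y => γ + φ y + Bᶜ.indicator (fun _ => b) y with hψ
    by_cases hcase : ∃ n ∈ I, Real.exp (-∑ i ∈ Finset.range n, φ (f^[i] x)) ≤ dict n (itin f P n x)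
    · obtain ⟨n, hn, hdn⟩ := hcase
      have hnN : n ≤ N + 1 := (Finset.mem_filter.1 hn).2
      refine le_trans ?_ (le_add_of_nonneg_of_le hfirst (Finset.single_le_sum hterm hn))
      rw [itin_take f P hnN, itin_drop]
      have h1 := hq2 (N + 1 - n) (hIpos n hn) (f^[n] x)
      refine le_trans ?_ (mul_le_mul_of_nonneg_left (mul_le_mul hdn h1 (Real.exp_pos _).le
        (hdict0 _ _)) (Real.exp_pos _).le)
      rw [← Real.exp_add, ← Real.exp_add, Real.exp_le_exp]
      have h2 : ∑ i ∈ Finset.range (N + 1), ψ (f^[i] x) = ∑ i ∈ Finset.range n, ψ (f^[i] x) +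
          ∑ i ∈ Finset.range (N + 1 - n), ψ (f^[i] (f^[n] x)) := by
        conv_lhs => rw [← Nat.add_sub_cancel' hnN, Finset.sum_range_add]
        simp only [← Function.iterate_add_apply, Nat.add_comm n]
      have h3 : γ * n + ∑ i ∈ Finset.range n, φ (f^[i] x) ≤ ∑ i ∈ Finset.range n, ψ (f^[i] x) := by
        have : γ * n + ∑ i ∈ Finset.range n, φ (f^[i] x) =
            ∑ i ∈ Finset.range n, (γ + φ (f^[i] x)) := by
          rw [Finset.sum_add_distrib]; simp [mul_comm]
        rw [this]
        exact Finset.sum_le_sum fun i _ => le_add_of_nonneg_right (hind _)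
      have h4 : b * (min (N + 1 - n) M : ℕ) ≤ b * (min (N + 1) M : ℕ) := by
        gcongr; omega
      linarith
    · refine le_trans ?_ (le_add_of_le_of_nonneg ?_ (Finset.sum_nonneg hterm))
        (b := Real.exp (-b) * q N (itin f P (N + 1) x).tail)
      swap
      · exact le_rfl
      have h1 := hq2 N (by omega) (f x)
      refine le_trans ?_ (mul_le_mul_of_nonneg_left h1 (Real.exp_pos _).le)
      rw [← Real.exp_add, Real.exp_le_exp]
      have h2 : ∑ i ∈ Finset.range (N + 1), ψ (f^[i] x) =
          ∑ i ∈ Finset.range N, ψ (f^[i] (f x)) + ψ x := by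
        rw [Finset.sum_range_succ']; rfl
      suffices b + b * (min N M : ℕ) ≤ ψ x + b * (min (N + 1) M : ℕ) by linarith
      have hγφ := hφ x
      by_cases hx : x ∈ B
      · obtain ⟨n, hn, hdn⟩ := hB x hx
        have hnN : N + 1 < n := by
          by_contra hle
          exact hcase ⟨n, Finset.mem_filter.2 ⟨hn, by omega⟩, hdn⟩
        have hnM := (Finset.mem_Icc.1 hn).2
        rw [min_eq_left (by omega), min_eq_left (by omega)]
        have := hind x
        push_cast
        simp only [hψ]
        linarith
      · have h4 : b * (min N M : ℕ) ≤ b * (min (N + 1) M : ℕ) := by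
          gcongr; omega
        simp only [hψ, indicator_of_mem (mem_compl hx)]
        linarith

end Coding

section Gibbs

variable {X : Type*} [MeasurableSpace X] {f : X → X} {μ : Measure X}

theorem negMulLog_le_mul_add_sub {p q ℓ : ℝ} (hp : 0 ≤ p) (hq : Real.exp (-ℓ) ≤ q) :
    Real.negMulLog p ≤ p * ℓ + q - p := by
  rcases hp.eq_or_lt with rfl | hp
  · simpa using (Real.exp_pos _).le.trans hq
  have hq0 := (Real.exp_pos _).trans_le hq
  have h1 : -ℓ ≤ Real.log q := (Real.le_log_iff_exp_le hq0).2 hq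
  have h2 := Real.log_le_sub_one_of_pos (div_pos hq0 hp)
  rw [Real.log_div hq0.ne' hp.ne'] at h2
  have h3 := mul_le_mul_of_nonneg_left h2 hp.le
  have h4 : p * (q / p - 1) = q - p := by field_simp
  have h5 := mul_le_mul_of_nonneg_left h1 hp.le
  rw [Real.negMulLog]
  linarith

/-- The Gibbs inequality for the entropy of itineraries. -/
theorem partHn_le_integral [IsProbabilityMeasure μ] {k : ℕ} {P : X → Fin k} (hf : Measurable f)
    (hP : Measurable P) {N : ℕ} {q : List (Fin k) → ℝ} (hq0 : ∀ w, 0 ≤ q w) (hq1 : sumW N q ≤ 1)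
    {Φ : X → ℝ} (hΦ : Integrable Φ μ) (hq : ∀ x, Real.exp (-Φ x) ≤ q (itin f P N x)) :
    partHn f μ P N ≤ ∫ x, Φ x ∂μ := by
  set cyl : (Fin N → Fin k) → Set X := fun c => {x | ∀ i : Fin N, P (f^[(i : ℕ)] x) = c i} with hcyl
  have hmeas : ∀ c, MeasurableSet (cyl c) := fun c => by
    simp only [hcyl, Set.ofPred_forall]
    exact MeasurableSet.iInter fun i => (hP.comp (hf.iterate i)) (measurableSet_singleton (c i))
  have hdisj : Pairwise (Function.onFun Disjoint cyl) := fun c d hcd => by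
    refine Set.disjoint_left.2 fun x hc hd => hcd (funext fun i => ?_)
    rw [← hc i, hd i]
  have huniv : ⋃ c, cyl c = univ :=
    eq_univ_of_forall fun x => mem_iUnion.2 ⟨fun i => P (f^[i] x), fun i => rfl⟩
  have h_int : ∫ x, Φ x ∂μ = ∑ c, ∫ x in cyl c, Φ x ∂μ := by
    rw [← setIntegral_univ, ← huniv, integral_iUnion_fintype hmeas hdisj fun c => hΦ.integrableOn]
  have hone : ∑ c, μ.real (cyl c) = 1 := by
    rw [← measureReal_iUnion_fintype hdisj hmeas, huniv, probReal_univ]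
  have hterm : ∀ c, Real.negMulLog (μ.real (cyl c)) ≤
      ∫ x in cyl c, Φ x ∂μ + q (List.ofFn c) - μ.real (cyl c) := by
    intro c
    by_cases h0 : μ.real (cyl c) = 0
    · have h1 : μ (cyl c) = 0 := (measureReal_eq_zero_iff).1 h0
      rw [h0, Measure.restrict_eq_zero.2 h1]
      simpa using hq0 _
    have hitin : ∀ x ∈ cyl c, itin f P N x = List.ofFn c := fun x hx => by
      rw [itin_eq_ofFn]
      congr 1
      exact funext hx
    have hne : (cyl c).Nonempty := nonempty_of_measureReal_ne_zero h0
    obtain ⟨x₀, hx₀⟩ := hne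
    have hqpos : 0 < q (List.ofFn c) := by
      rw [← hitin x₀ hx₀]; exact (Real.exp_pos _).trans_le (hq x₀)
    have h1 := negMulLog_le_mul_add_sub (p := μ.real (cyl c)) (q := q (List.ofFn c))
      (ℓ := -Real.log (q (List.ofFn c))) measureReal_nonneg (by rw [neg_neg, Real.exp_log hqpos])
    have h2 : μ.real (cyl c) * (-Real.log (q (List.ofFn c))) ≤ ∫ x in cyl c, Φ x ∂μ := by
      have h3 := setIntegral_mono_on (μ := μ) (integrableOn_const (s := cyl c)
        (C := -Real.log (q (List.ofFn c))) (measure_ne_top _ _)) hΦ.integrableOn (hmeas c)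
        fun x hx => by
          have := hq x
          rw [hitin x hx] at this
          have := (Real.le_log_iff_exp_le hqpos).2 this
          linarith
      simpa using h3
    linarith
  have hsum : ∑ c : Fin N → Fin k, q (List.ofFn c) ≤ 1 := by rwa [← sumW_eq_sum_ofFn]
  calc partHn f μ P N = ∑ c, Real.negMulLog (μ.real (cyl c)) := rfl
    _ ≤ ∑ c, (∫ x in cyl c, Φ x ∂μ + q (List.ofFn c) - μ.real (cyl c)) :=
        Finset.sum_le_sum fun c _ => hterm c
    _ ≤ ∫ x, Φ x ∂μ := by
        rw [Finset.sum_sub_distrib, Finset.sum_add_distrib, h_int, hone]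
        linarith

theorem partHn_nonneg [IsProbabilityMeasure μ] {k : ℕ} (P : X → Fin k) (N : ℕ) :
    0 ≤ partHn f μ P N :=
  Finset.sum_nonneg fun _ _ => Real.negMulLog_nonneg ENNReal.toReal_nonneg
    (by exact measureReal_le_one)

end Gibbs

section SeparatedPartition

variable {X : Type*} [MetricSpace X]

/-- Off a small set, the element of a finite measurable partition containing a point is determined
by any sufficiently good approximation of the point. -/
theorem exists_approx_label [CompactSpace X] [MeasurableSpace X] [BorelSpace X] (μ : Measure X)
    [IsProbabilityMeasure μ] {k : ℕ} {P : X → Fin k} (hP : Measurable P) {ρ : ℝ} (hρ : 0 < ρ) :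
    ∃ R : Set X, MeasurableSet R ∧ μ.real R ≤ ρ ∧ ∃ σ > 0, ∃ lab : X → Fin k,
      ∀ x ∉ R, ∀ y, dist x y < 2 * σ → lab y = P x := by
  have hk : ∀ c : Fin k, ∃ K ⊆ P ⁻¹' {c}, IsCompact K ∧
      μ.real (P ⁻¹' {c} \ K) ≤ ρ / k := fun c => by
    have hkpos : 0 < k := c.pos
    have hpos : ENNReal.ofReal (ρ / k) ≠ 0 := by
      rw [Ne, ENNReal.ofReal_eq_zero, not_le]; positivity
    obtain ⟨K, hK, hKc, hlt⟩ := (hP (measurableSet_singleton c)).exists_isCompact_sdiff_lt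
      (measure_ne_top μ _) hpos
    refine ⟨K, hK, hKc, ?_⟩
    exact ENNReal.toReal_le_of_le_ofReal (by positivity) hlt.le
  choose K hK hKc hKm using hk
  have hsep : ∀ c d : Fin k, ∃ r > 0, c ≠ d → ∀ x ∈ K c, ∀ y ∈ K d, r ≤ dist x y := fun c d => by
    by_cases hcd : c = d
    · exact ⟨1, one_pos, fun h => absurd hcd h⟩
    have hdisj : Disjoint (K c) (K d) := Set.disjoint_left.2 fun x hc hd =>
      hcd ((hK c hc).symm.trans (hK d hd))
    obtain ⟨r, hr, h⟩ := Metric.exists_pos_forall_lt_edist (hKc c) (hKc d).isClosed hdisj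
    refine ⟨r, by exact_mod_cast hr, fun _ x hx y hy => ?_⟩
    have := h x hx y hy
    rw [edist_nndist] at this
    have h2 : r < nndist x y := by exact_mod_cast this
    exact_mod_cast h2.le
  choose r hr hrsep using hsep
  obtain ⟨σ, hσ, hσr⟩ : ∃ σ > 0, ∀ c d, 4 * σ ≤ r c d := by
    obtain ⟨σ, hσ, h⟩ : ∃ σ > 0, ∀ p : Fin k × Fin k, σ ≤ r p.1 p.2 := by
      by_cases hne : Nonempty (Fin k × Fin k)
      · obtain ⟨p, hp⟩ := Finite.exists_min fun p : Fin k × Fin k => r p.1 p.2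
        exact ⟨r p.1 p.2, hr _ _, hp⟩
      · exact ⟨1, one_pos, fun p => absurd ⟨p⟩ hne⟩
    exact ⟨σ / 4, by positivity, fun c d => by linarith [h (c, d)]⟩
  classical
  refine ⟨(⋃ c, K c)ᶜ, (MeasurableSet.iUnion fun c => (hKc c).measurableSet).compl, ?_, σ, hσ,
    fun y => if h : ∃ c, ∃ x ∈ K c, dist x y < 2 * σ then h.choose else P y, fun x hx y hxy => ?_⟩
  · have hsub : (⋃ c, K c)ᶜ ⊆ ⋃ c, (P ⁻¹' {c} \ K c) := fun x hx =>
      mem_iUnion.2 ⟨P x, rfl, fun h => hx (mem_iUnion.2 ⟨_, h⟩)⟩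
    calc μ.real (⋃ c, K c)ᶜ ≤ μ.real (⋃ c, (P ⁻¹' {c} \ K c)) := measureReal_mono hsub
      _ ≤ ∑ c, μ.real (P ⁻¹' {c} \ K c) := measureReal_iUnion_fintype_le _
      _ ≤ ∑ _c : Fin k, ρ / k := Finset.sum_le_sum fun c _ => hKm c
      _ ≤ ρ := by
        rw [Finset.sum_const, Finset.card_univ, Fintype.card_fin, nsmul_eq_mul]
        rcases Nat.eq_zero_or_pos k with rfl | hk
        · simpa using hρ.le
        · rw [mul_div_cancel₀ _ (by positivity)]
  · obtain ⟨c, hc⟩ := mem_iUnion.1 (not_not.1 hx)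
    have hex : ∃ c, ∃ x ∈ K c, dist x y < 2 * σ := ⟨c, x, hc, hxy⟩
    beta_reduce
    rw [dif_pos hex]
    obtain ⟨x', hx', hxy'⟩ := hex.choose_spec
    rw [show P x = c from hK c hc]
    by_contra hne
    have h1 := hrsep _ _ hne x' hx' x hc
    have h2 := hσr hex.choose c
    have h3 := dist_triangle_right x' x y
    linarith

end SeparatedPartition

section Dictionary

variable {X : Type*}

/-- The weight of the word `w` when the letters are perturbations of the labels along the orbit
of `y`. -/
def orbitWeight {α : Type*} (f : X → X) (lab : X → α) (r : α → α → ℝ) : List α → X → ℝ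
  | [], _ => 1
  | a :: w, y => r a (lab y) * orbitWeight f lab r w (f y)

theorem orbitWeight_nonneg {α : Type*} (f : X → X) (lab : X → α) {r : α → α → ℝ}
    (hr : ∀ a b, 0 ≤ r a b) (w : List α) (y : X) : 0 ≤ orbitWeight f lab r w y := by
  induction w generalizing y with
  | nil => exact zero_le_one
  | cons a w ih => exact mul_nonneg (hr _ _) (ih _)

theorem sumW_orbitWeight {α : Type*} [Fintype α] (f : X → X) (lab : X → α) {r : α → α → ℝ}
    (hr : ∀ b, ∑ a, r a b = 1) (n : ℕ) (y : X) :
    sumW n (fun w => orbitWeight f lab r w y) = 1 := by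
  induction n generalizing y with
  | zero => rfl
  | succ n ih => simp [sumW, orbitWeight, sumW_mul_left, ih, hr]

theorem exists_label_weight (k : ℕ) {γ : ℝ} (hγ : 0 < γ) :
    ∃ b ≥ 0, ∃ r : Fin k → Fin k → ℝ, (∀ c d, 0 ≤ r c d) ∧ (∀ d, ∑ c, r c d = 1) ∧
      (∀ c, Real.exp (-γ) ≤ r c c) ∧ ∀ c d, Real.exp (-(γ + b)) ≤ r c d := by
  set e := 1 - Real.exp (-γ) with he
  have he0 : 0 < e := by
    have : Real.exp (-γ) < 1 := Real.exp_lt_one_iff.2 (by linarith)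
    linarith
  have he1 : e ≤ 1 := by linarith [Real.exp_pos (-γ)]
  rcases Nat.eq_zero_or_pos k with rfl | hk
  · exact ⟨0, le_rfl, fun _ _ => 0, fun c => c.elim0, fun c => c.elim0, fun c => c.elim0,
      fun c => c.elim0⟩
  have hk1 : (1 : ℝ) ≤ k := by exact_mod_cast hk
  have hk0 : (0 : ℝ) < k := by linarith
  have hexp : Real.exp (-Real.log (k / e)) = e / k := by
    rw [Real.exp_neg, Real.exp_log (by positivity), inv_div]
  refine ⟨Real.log (k / e), Real.log_nonneg ?_,
    fun c d => (if c = d then Real.exp (-γ) else 0) + e / k, fun c d => ?_, fun d => ?_,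
    fun c => ?_, fun c d => ?_⟩
  · rw [le_div_iff₀ he0]; linarith
  · have : 0 < e / k := by positivity
    beta_reduce
    split_ifs <;> positivity
  · rw [Finset.sum_add_distrib]
    simp
    field_simp
    rw [he]; ring
  · have : 0 < e / k := by positivity
    simp
    positivity
  · have h1 : Real.exp (-(γ + Real.log (k / e))) ≤ e / k := by
      rw [← hexp, Real.exp_le_exp]; linarith
    have : 0 ≤ (if c = d then Real.exp (-γ) else 0) := by split_ifs <;> positivity
    linarith

theorem le_orbitWeight_itin {α : Type*} [PseudoMetricSpace X] {f : X → X} {P lab : X → α}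
    {R : Set X} {σ : ℝ}
    (hlab : ∀ x ∉ R, ∀ y, dist x y < 2 * σ → lab y = P x) {r : α → α → ℝ} {γ b : ℝ}
    (hr : ∀ c d, 0 ≤ r c d)
    (hr1 : ∀ c, Real.exp (-γ) ≤ r c c) (hr2 : ∀ c d, Real.exp (-(γ + b)) ≤ r c d)
    (n : ℕ) (x y : X) (hxy : ∀ i < n, dist (f^[i] x) (f^[i] y) < 2 * σ) :
    Real.exp (-∑ i ∈ Finset.range n, (γ + R.indicator (fun _ => b) (f^[i] x))) ≤
      orbitWeight f lab r (itin f P n x) y := by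
  induction n generalizing x y with
  | zero => simp [itin, orbitWeight]
  | succ n ih =>
    rw [Finset.sum_range_succ', neg_add_rev, Real.exp_add, itin, orbitWeight]
    refine mul_le_mul ?_ (ih (f x) (f y) fun i hi => hxy (i + 1) (by omega)) (Real.exp_pos _).le
      (hr _ _)
    by_cases hx : x ∈ R
    · simpa [hx] using hr2 _ _
    · rw [hlab x hx y (hxy 0 (by omega))]
      simpa [hx] using hr1 _

variable [MetricSpace X]

theorem isOpen_dynBall {f : X → X} (hf : Continuous f) (x : X) (n : ℕ) (σ : ℝ) :
    IsOpen (dynBall f x n σ) := by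
  have : dynBall f x n σ = ⋂ i ∈ Finset.range n, {y | dist (f^[i] x) (f^[i] y) < σ} := by
    ext y; simp [dynBall]
  rw [this]
  exact isOpen_biInter_finset fun i _ =>
    isOpen_lt (continuous_const.dist (hf.iterate i)) continuous_const

theorem mem_dynBall_self {f : X → X} (x : X) (n : ℕ) {σ : ℝ} (hσ : 0 < σ) :
    x ∈ dynBall f x n σ := fun i _ => by rwa [dist_self]

/-- A maximal family of disjoint Bowen balls of measure at least `e^{-ns}` gives a dictionary for
the points whose Bowen balls have measure at least `e^{-ns}`. -/
theorem exists_dictionary [MeasurableSpace X] [BorelSpace X] {f : X → X} (hf : Continuous f) (μ : Measure X)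
    [IsProbabilityMeasure μ] {k : ℕ} {P lab : X → Fin k} {R : Set X} {σ : ℝ} (hσ : 0 < σ)
    (hlab : ∀ x ∉ R, ∀ y, dist x y < 2 * σ → lab y = P x) {r : Fin k → Fin k → ℝ} {γ b : ℝ}
    (hr : ∀ c d, 0 ≤ r c d) (hrsum : ∀ d, ∑ c, r c d = 1)
    (hr1 : ∀ c, Real.exp (-γ) ≤ r c c) (hr2 : ∀ c d, Real.exp (-(γ + b)) ≤ r c d)
    (s : ℝ) (n : ℕ) :
    ∃ dict : List (Fin k) → ℝ, (∀ w, 0 ≤ dict w) ∧ sumW n dict ≤ 1 ∧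
      ∀ x, Real.exp (-s * n) ≤ μ.real (dynBall f x n σ) →
        Real.exp (-∑ i ∈ Finset.range n, (s + γ + R.indicator (fun _ => b) (f^[i] x))) ≤
          dict (itin f P n x) := by
  classical
  let good : Finset X → Prop := fun D =>
    (∀ y ∈ D, Real.exp (-s * n) ≤ μ.real (dynBall f y n σ)) ∧
      (D : Set X).PairwiseDisjoint fun y => dynBall f y n σ
  have hcard : ∀ D, good D → Real.exp (-s * n) * D.card ≤ 1 := fun D hD => by
    have h1 : ∑ y ∈ D, μ.real (dynBall f y n σ) ≤ 1 := by
      rw [← measureReal_biUnion_finset hD.2 fun y _ => (isOpen_dynBall hf y n σ).measurableSet]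
      exact measureReal_le_one
    have h2 := Finset.card_nsmul_le_sum D _ _ hD.1
    rw [nsmul_eq_mul] at h2
    linarith
  have hbdd : BddAbove {j | ∃ D, good D ∧ D.card = j} := by
    refine ⟨⌊Real.exp (s * n)⌋₊, ?_⟩
    rintro _ ⟨D, hD, rfl⟩
    refine Nat.le_floor ?_
    have := mul_le_mul_of_nonneg_left (hcard D hD) (Real.exp_pos (s * n)).le
    rwa [← mul_assoc, ← Real.exp_add, neg_mul, add_neg_cancel, Real.exp_zero, one_mul,
      mul_one] at this
  have hne : {j | ∃ D, good D ∧ D.card = j}.Nonempty := ⟨0, ∅, ⟨by simp, by simp⟩, rfl⟩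
  obtain ⟨D, hD, hDmax⟩ := Nat.sSup_mem hne hbdd
  refine ⟨fun w => Real.exp (-s * n) * ∑ y ∈ D, orbitWeight f lab r w y, fun w => ?_, ?_,
    fun x hx => ?_⟩
  · exact mul_nonneg (Real.exp_pos _).le
      (Finset.sum_nonneg fun y _ => orbitWeight_nonneg f lab hr w y)
  · rw [sumW_mul_left, sumW_sum]
    simpa [sumW_orbitWeight f lab hrsum] using hcard D hD
  · obtain ⟨y, hy, hxy⟩ : ∃ y ∈ D, ∀ i < n, dist (f^[i] x) (f^[i] y) < 2 * σ := by
      by_contra! hcon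
      have hxD : x ∉ D := fun h => by
        obtain ⟨i, -, hi⟩ := hcon x h
        rw [dist_self] at hi
        linarith
      have hgood : good (insert x D) := by
        refine ⟨fun y hy => ?_, ?_⟩
        · rcases Finset.mem_insert.1 hy with rfl | hy
          exacts [hx, hD.1 y hy]
        · rw [Finset.coe_insert]
          refine hD.2.insert fun y hy _ => Set.disjoint_left.2 fun z hzx hzy => ?_
          obtain ⟨i, hi, hi'⟩ := hcon y hy
          have h1 := hzx i hi
          have h2 := hzy i hi
          linarith [dist_triangle_right (f^[i] x) (f^[i] y) (f^[i] z)]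
      have := le_csSup hbdd ⟨insert x D, hgood, rfl⟩
      rw [← hDmax, Finset.card_insert_of_notMem hxD] at this
      omega
    have h1 := le_orbitWeight_itin hlab hr hr1 hr2 n x y hxy
    refine le_trans ?_ (mul_le_mul_of_nonneg_left (h1.trans (Finset.single_le_sum
      (fun y _ => orbitWeight_nonneg f lab hr _ y) hy)) (Real.exp_pos _).le)
    rw [← Real.exp_add, Real.exp_le_exp]
    simp only [Finset.sum_add_distrib, Finset.sum_const, Finset.card_range, nsmul_eq_mul]
    linarith

end Dictionary

section BrinKatok

theorem dynBall_succ_subset_preimage {X : Type*} [MetricSpace X] {f : X → X} (x : X) (n : ℕ) (σ : ℝ) :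
    dynBall f x (n + 1) σ ⊆ f ⁻¹' dynBall f (f x) n σ := fun _ hy i hi => hy (i + 1) (by omega)

variable {X : Type*} [MetricSpace X] [CompactSpace X] [MeasurableSpace X] [BorelSpace X]
  {f : X → X} {μ : Measure X} [IsProbabilityMeasure μ]

theorem measurable_measureReal_dynBall (hf : Continuous f) (n : ℕ) (σ : ℝ) :
    Measurable fun x => μ.real (dynBall f x n σ) := by
  have hopen : IsOpen {p : X × X | ∀ i < n, dist (f^[i] p.1) (f^[i] p.2) < σ} := by
    have : {p : X × X | ∀ i < n, dist (f^[i] p.1) (f^[i] p.2) < σ} =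
        ⋂ i ∈ Finset.range n, {p : X × X | dist (f^[i] p.1) (f^[i] p.2) < σ} := by
      ext y; simp
    rw [this]
    exact isOpen_biInter_finset fun i _ => isOpen_lt
      (((hf.iterate i).comp continuous_fst).dist ((hf.iterate i).comp continuous_snd))
      continuous_const
  exact (measurable_measure_prodMk_left hopen.measurableSet).ennreal_toReal

theorem exists_forall_sum_Icc_exp_le {γ : ℝ} (hγ : 0 < γ) :
    ∃ L : ℕ, 1 ≤ L ∧ ∀ M, ∑ n ∈ Finset.Icc L M, Real.exp (-γ * n) ≤ 1 / 2 := by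
  have hs : Summable fun n : ℕ => Real.exp (-γ * n) := by
    simpa only [mul_comm] using Real.summable_exp_nat_mul_iff.2 (neg_lt_zero.2 hγ)
  obtain ⟨s, hs⟩ := summable_iff_vanishing_norm.1 hs (1 / 2) (by norm_num)
  refine ⟨s.sup id + 1, by omega, fun M => ?_⟩
  have h := hs (Finset.Icc (s.sup id + 1) M) (Finset.disjoint_left.2 fun n hn hns => by
    have h1 : n ≤ s.sup id := Finset.le_sup (f := id) hns
    have h2 := (Finset.mem_Icc.1 hn).1
    omega)
  exact (le_abs_self _).trans h.le

/-- If almost every point has infinitely many Bowen balls of measure at least `e^{-ns}`, then the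
entropy of a partition is not much larger than `s`. -/
theorem entropy_le_of_frequently_large_dynBall (hf : Continuous f) (hμ : MeasurePreserving f μ μ)
    {k : ℕ} {P lab : X → Fin k} (hP : Measurable P) {R : Set X} (hR : MeasurableSet R) {σ : ℝ}
    (hσ : 0 < σ) (hlab : ∀ x ∉ R, ∀ y, dist x y < 2 * σ → lab y = P x)
    {r : Fin k → Fin k → ℝ} {γ b : ℝ} (hγ : 0 < γ) (hb : 0 ≤ b)
    (hr : ∀ c d, 0 ≤ r c d) (hrsum : ∀ d, ∑ c, r c d = 1)
    (hr1 : ∀ c, Real.exp (-γ) ≤ r c c) (hr2 : ∀ c d, Real.exp (-(γ + b)) ≤ r c d)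
    (hbR : b * μ.real R ≤ γ) {s : ℝ} (hs : 0 ≤ s)
    (hfreq : ∀ᵐ x ∂μ, ∀ L : ℕ, ∃ n ≥ L, Real.exp (-s * n) ≤ μ.real (dynBall f x n σ))
    {h : ℝ} (hh : ∀ N : ℕ, h * N ≤ partHn f μ P N) : h ≤ s + 4 * γ := by
  obtain ⟨L, hL, hLsum⟩ := exists_forall_sum_Icc_exp_le hγ
  choose dict hdict0 hdict1 hdict2 using
    exists_dictionary hf μ hσ hlab hr hrsum hr1 hr2 s
  obtain ⟨x₀⟩ : Nonempty X := nonempty_of_isProbabilityMeasure μ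
  have hk : (1 : ℝ) ≤ k := by exact_mod_cast (P x₀).pos
  set b' := Real.log (2 * k) with hb'
  have hb'0 : 0 ≤ b' := Real.log_nonneg (by linarith)
  set B : ℕ → Set X := fun M => ⋃ n ∈ Finset.Icc L M,
    {x | Real.exp (-s * n) ≤ μ.real (dynBall f x n σ)} with hBdef
  have hBm : ∀ M, MeasurableSet (B M) := fun M =>
    Finset.measurableSet_biUnion _ fun n _ =>
      measurableSet_le measurable_const (measurable_measureReal_dynBall hf n σ)
  have hBmono : Monotone B := fun M M' hM => by
    refine Set.biUnion_subset_biUnion_left fun n hn => ?_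
    exact Finset.Icc_subset_Icc_right hM hn
  have hBtend : Tendsto (fun M => μ.real (B M)ᶜ) atTop (𝓝 0) := by
    have h1 : μ (⋃ M, B M) = 1 := by
      rw [← prob_compl_eq_zero_iff (MeasurableSet.iUnion hBm)]
      refine measure_mono_null (fun x hx => ?_) (ae_iff.1 hfreq)
      refine fun hx' => hx ?_
      obtain ⟨n, hn, hx'⟩ := hx' L
      exact mem_iUnion.2 ⟨n, mem_biUnion (Finset.mem_coe.2 (Finset.mem_Icc.2 ⟨hn, le_rfl⟩)) hx'⟩
    have h2 := tendsto_measure_iUnion_atTop (μ := μ) hBmono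
    rw [h1] at h2
    have h3 := (ENNReal.tendsto_toReal ENNReal.one_ne_top).comp h2
    have h4 : (fun M => μ.real (B M)ᶜ) = fun M => 1 - μ.real (B M) := by
      funext M; rw [probReal_compl_eq_one_sub (hBm M)]
    rw [h4]
    simpa [Measure.real] using h3.const_sub 1
  obtain ⟨M, hM⟩ : ∃ M, b' * μ.real (B M)ᶜ ≤ γ := by
    have h1 : Tendsto (fun M => b' * μ.real (B M)ᶜ) atTop (𝓝 0) := by
      simpa using hBtend.const_mul b'
    exact ((h1.eventually (gt_mem_nhds hγ)).exists).imp fun M h => h.le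
  set φ : X → ℝ := fun x => s + γ + R.indicator (fun _ => b) x with hφ
  have hRind : ∀ x, 0 ≤ R.indicator (fun _ => b) x := fun x => indicator_nonneg (fun _ _ => hb) x
  have hBdict : ∀ x ∈ B M, ∃ n ∈ Finset.Icc L M,
      Real.exp (-∑ i ∈ Finset.range n, φ (f^[i] x)) ≤ dict n (itin f P n x) := fun x hx => by
    obtain ⟨n, hn, hx⟩ := mem_iUnion₂.1 hx
    exact ⟨n, hn, hdict2 n x hx⟩
  set ψ : X → ℝ := fun x => γ + φ x + (B M)ᶜ.indicator (fun _ => b') x with hψ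
  have hRi : Integrable (R.indicator fun _ => b) μ := (integrable_const _).indicator hR
  have hBi : Integrable ((B M)ᶜ.indicator fun _ => b') μ :=
    (integrable_const _).indicator (hBm M).compl
  have hφi : Integrable φ μ := (integrable_const (s + γ)).add hRi
  have hγφi : Integrable (fun x => γ + φ x) μ := (integrable_const γ).add hφi
  have hψi : Integrable ψ μ := hγφi.add hBi
  have hψint : ∫ x, ψ x ∂μ ≤ s + 4 * γ := by
    have h1 : ∫ x, ψ x ∂μ = γ + (s + γ + b * μ.real R) + b' * μ.real (B M)ᶜ := by
      simp only [hψ]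
      rw [integral_add hγφi hBi, integral_add (integrable_const γ) hφi]
      simp only [hφ]
      rw [integral_add (integrable_const (s + γ)) hRi, integral_indicator_const _ hR,
        integral_indicator_const _ (hBm M).compl]
      simp [mul_comm]
    linarith
  have hupper : ∀ N : ℕ, partHn f μ P N ≤ (s + 4 * γ) * N + b' * M := fun N => by
    obtain ⟨q, hq0, hq1, hq2⟩ := exists_coding (f := f) (P := P) hdict0 hdict1 hL (hLsum M) hBdict
      hb'0 (by rw [Fintype.card_fin, hb', Real.exp_log (by linarith)])
      (fun x => by have := hRind x; simp only [hφ]; linarith) N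
    obtain ⟨hSi, hSint⟩ := integral_sum_iterate hμ hψi N
    have h1 := partHn_le_integral hf.measurable hP hq0 hq1
      (hSi.add (integrable_const (b' * (min N M : ℕ)))) hq2
    rw [integral_add' hSi (integrable_const _), hSint, integral_const, probReal_univ,
      one_smul] at h1
    have h3 : N * ∫ x, ψ x ∂μ ≤ N * (s + 4 * γ) := by gcongr
    have h4 : b' * (min N M : ℕ) ≤ b' * M := by gcongr; exact min_le_right _ _
    linarith
  by_contra! hlt
  obtain ⟨N, hN⟩ := exists_nat_gt (b' * M / (h - (s + 4 * γ)))
  rw [div_lt_iff₀ (by linarith)] at hN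
  have := (hh N).trans (hupper N)
  linarith

/-- The lower bound in the Brin–Katok local entropy formula, at a fixed scale. -/
theorem exists_large_set_measure_dynBall_le (hf : Continuous f) (hμ : Ergodic f μ) {s : ℝ}
    (hs : (s : EReal) < ksEnt f μ) :
    ∃ σ > 0, ∀ δ > 0, ∃ n₀ : ℕ, ∃ G : Set X, MeasurableSet G ∧ μ.real Gᶜ ≤ δ ∧
      ∀ x ∈ G, ∀ n ≥ n₀, μ.real (dynBall f x n σ) ≤ Real.exp (-s * n) := by
  rcases lt_or_ge s 0 with hs0 | hs0
  · refine ⟨1, one_pos, fun δ hδ => ⟨0, univ, MeasurableSet.univ, by simpa using hδ.le,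
      fun x _ n _ => measureReal_le_one.trans (Real.one_le_exp ?_)⟩⟩
    have : 0 ≤ -s := by linarith
    positivity
  obtain ⟨k, P, hP, hsP⟩ : ∃ (k : ℕ) (P : X → Fin k) (_ : Measurable P),
      s < ⨅ n : ℕ, partHn f μ P (n + 1) / ((n : ℝ) + 1) := by
    simp only [ksEnt, lt_iSup_iff] at hs
    obtain ⟨k, P, hP, h⟩ := hs
    exact ⟨k, P, hP, by exact_mod_cast h⟩
  set h := ⨅ n : ℕ, partHn f μ P (n + 1) / ((n : ℝ) + 1) with hh
  have hhN : ∀ N : ℕ, h * N ≤ partHn f μ P N := fun N => by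
    cases N with
    | zero => simpa using partHn_nonneg P 0
    | succ N =>
      have h1 : h ≤ partHn f μ P (N + 1) / ((N : ℝ) + 1) := ciInf_le
        ⟨0, by rintro _ ⟨n, rfl⟩; exact div_nonneg (partHn_nonneg _ _) (by positivity)⟩ N
      rw [le_div_iff₀ (by positivity)] at h1
      exact_mod_cast h1
  set γ := (h - s) / 8 with hγdef
  have hγ : 0 < γ := by simp only [hγdef]; linarith
  obtain ⟨b, hb, r, hr, hrsum, hr1, hr2⟩ := exists_label_weight k hγ
  obtain ⟨R, hR, hRm, σ, hσ, lab, hlab⟩ := exists_approx_label μ hP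
    (show 0 < γ / (b + 1) by positivity)
  have hbR : b * μ.real R ≤ γ := by
    calc b * μ.real R ≤ (b + 1) * (γ / (b + 1)) := by gcongr; linarith
      _ = γ := by field_simp
  refine ⟨σ, hσ, fun δ hδ => ?_⟩
  set V : Set X := {x | ∃ C : ℕ, ∃ᶠ n : ℕ in atTop,
    Real.exp (-s * n) ≤ (C + 1) * μ.real (dynBall f x n σ)} with hV
  have hVm : MeasurableSet V := by
    have : V = ⋃ C : ℕ, ⋂ N : ℕ, ⋃ n : ℕ, ⋃ _ : N ≤ n,
        {x | Real.exp (-s * n) ≤ (C + 1) * μ.real (dynBall f x n σ)} := by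
      ext x
      simp [hV, frequently_atTop]
    rw [this]
    exact MeasurableSet.iUnion fun C => MeasurableSet.iInter fun N => MeasurableSet.iUnion fun n =>
      MeasurableSet.iUnion fun _ => measurableSet_le measurable_const
        ((measurable_measureReal_dynBall hf n σ).const_mul _)
  have hVinv : V ⊆ f ⁻¹' V := by
    rintro x ⟨C, hC⟩
    obtain ⟨C', hC'⟩ := exists_nat_ge (Real.exp s * (C + 1))
    refine ⟨C', frequently_atTop.2 fun N => ?_⟩
    obtain ⟨n, hn, hCn⟩ := frequently_atTop.1 hC (N + 1)
    obtain ⟨n, rfl⟩ : ∃ j, n = j + 1 := ⟨n - 1, by omega⟩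
    refine ⟨n, by omega, ?_⟩
    have h1 : μ.real (dynBall f x (n + 1) σ) ≤ μ.real (dynBall f (f x) n σ) := by
      rw [← hμ.measureReal_preimage
        (isOpen_dynBall hf (f x) n σ).measurableSet.nullMeasurableSet]
      exact measureReal_mono (dynBall_succ_subset_preimage x n σ)
    have h2 : Real.exp (-s * n) = Real.exp s * Real.exp (-s * (n + 1 : ℕ)) := by
      rw [← Real.exp_add]; push_cast; ring_nf
    have h3 : 0 ≤ μ.real (dynBall f (f x) n σ) := measureReal_nonneg
    calc Real.exp (-s * n) ≤ Real.exp s * ((C + 1) * μ.real (dynBall f (f x) n σ)) := by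
          rw [h2]
          gcongr
          exact hCn.trans (by gcongr)
      _ = (Real.exp s * (C + 1)) * μ.real (dynBall f (f x) n σ) := by ring
      _ ≤ (C' + 1) * μ.real (dynBall f (f x) n σ) := by gcongr; linarith
  rcases hμ.ae_empty_or_univ_of_ae_le_preimage hVm.nullMeasurableSet
    (Eventually.of_forall hVinv) with h0 | h1
  · set G : ℕ → Set X := fun N => {x | ∀ n ≥ N, μ.real (dynBall f x n σ) ≤ Real.exp (-s * n)}
      with hG
    have hGm : ∀ N, MeasurableSet (G N) := fun N => by
      have : G N = ⋂ n : ℕ, ⋂ _ : N ≤ n, {x | μ.real (dynBall f x n σ) ≤ Real.exp (-s * n)} := by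
        ext x; simp [hG]
      rw [this]
      exact MeasurableSet.iInter fun n => MeasurableSet.iInter fun _ =>
        measurableSet_le (measurable_measureReal_dynBall hf n σ) measurable_const
    have hGmono : Monotone G := fun N N' hN x hx n hn => hx n (hN.trans hn)
    have hGtend : Tendsto (fun N => μ.real (G N)ᶜ) atTop (𝓝 0) := by
      have h1 : μ (⋃ N, G N) = 1 := by
        rw [← prob_compl_eq_zero_iff (MeasurableSet.iUnion hGm)]
        refine measure_mono_null (fun x hx => ?_) (ae_eq_empty.1 h0)
        refine ⟨0, frequently_atTop.2 fun N => ?_⟩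
        have h2 : x ∉ G N := fun h => hx (mem_iUnion.2 ⟨N, h⟩)
        simp only [hG, mem_ofPred_eq, not_forall, not_le] at h2
        obtain ⟨n, hn, h3⟩ := h2
        exact ⟨n, hn, by simpa using h3.le⟩
      have h2 := tendsto_measure_iUnion_atTop (μ := μ) hGmono
      rw [h1] at h2
      have h3 := (ENNReal.tendsto_toReal ENNReal.one_ne_top).comp h2
      have h4 : (fun N => μ.real (G N)ᶜ) = fun N => 1 - μ.real (G N) := by
        funext N; rw [probReal_compl_eq_one_sub (hGm N)]
      rw [h4]
      simpa [Measure.real] using h3.const_sub 1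
    obtain ⟨N, hN⟩ := (hGtend.eventually (gt_mem_nhds hδ)).exists
    exact ⟨N, G N, hGm N, hN.le, fun x hx => hx⟩
  · exfalso
    have hfreq : ∀ᵐ x ∂μ, ∀ L : ℕ, ∃ n ≥ L,
        Real.exp (-(s + γ) * n) ≤ μ.real (dynBall f x n σ) := by
      filter_upwards [ae_eq_univ.1 h1] with x hx L
      obtain ⟨C, hC⟩ : x ∈ V := hx
      obtain ⟨N, hN⟩ := exists_nat_ge (Real.log (C + 1) / γ)
      obtain ⟨n, hn, hCn⟩ := frequently_atTop.1 hC (L + N)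
      refine ⟨n, by omega, ?_⟩
      have hC0 : (0 : ℝ) < C + 1 := by positivity
      have h2 : (C + 1 : ℝ) ≤ Real.exp (γ * n) := by
        rw [← Real.log_le_iff_le_exp hC0]
        have h3 : (N : ℝ) ≤ n := by exact_mod_cast (by omega)
        rw [div_le_iff₀ hγ] at hN
        nlinarith
      have h4 : Real.exp (-(s + γ) * n) * Real.exp (γ * n) = Real.exp (-s * n) := by
        rw [← Real.exp_add]; ring_nf
      refine le_of_mul_le_mul_right ?_ hC0
      calc Real.exp (-(s + γ) * n) * (C + 1) ≤ Real.exp (-(s + γ) * n) * Real.exp (γ * n) := by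
            gcongr
        _ ≤ μ.real (dynBall f x n σ) * (C + 1) := by
            rw [h4, mul_comm (μ.real _)]; exact hCn
    have := entropy_le_of_frequently_large_dynBall hf hμ.toMeasurePreserving hP hR hσ hlab hγ hb hr
      hrsum hr1 hr2 hbR (add_nonneg hs0 hγ.le) hfreq hhN
    rw [hγdef] at this
    linarith

end BrinKatok

section SeparatedSets

variable {X : Type*} [MetricSpace X] {f : X → X}

theorem topEnt_mono {Y Z : Set X} (h : Y ⊆ Z) : topEnt f Y ≤ topEnt f Z :=
  iSup_mono fun _ => iSup_mono fun _ => iSup_mono' fun hE => ⟨hE.trans h, le_rfl⟩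

variable [CompactSpace X]

theorem bddAbove_card_isDynSep (hf : Continuous f) (E : Set X) (n : ℕ) {ε : ℝ} (hε : 0 < ε) :
    BddAbove {k | ∃ S : Finset X, IsDynSep f E n ε ↑S ∧ S.card = k} := by
  obtain ⟨t, -, ht⟩ := isCompact_univ.elim_nhds_subcover (fun x : X => dynBall f x n (ε / 2))
    fun x _ => (isOpen_dynBall hf x n _).mem_nhds (mem_dynBall_self x n (half_pos hε))
  refine ⟨t.card, ?_⟩
  rintro _ ⟨S, hS, rfl⟩
  have hcov : ∀ x : X, ∃ a ∈ t, x ∈ dynBall f a n (ε / 2) := fun x => by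
    simpa using ht (mem_univ x)
  choose c hct hc using hcov
  refine Finset.card_le_card_of_injOn c (fun x _ => hct x) fun x hx y hy hxy => ?_
  by_contra hne
  obtain ⟨i, hi, hd⟩ := hS.2 x hx y hy hne
  have h1 := hc x i hi
  have h2 := hc y i hi
  rw [← hxy] at h2
  linarith [dist_triangle_left (f^[i] x) (f^[i] y) (f^[i] (c x))]

theorem IsDynSep.card_le_sepCount (hf : Continuous f) {E : Set X} {n : ℕ} {ε : ℝ} (hε : 0 < ε)
    {S : Finset X} (hS : IsDynSep f E n ε ↑S) : S.card ≤ sepCount f E n ε :=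
  le_csSup (bddAbove_card_isDynSep hf E n hε) ⟨S, hS, rfl⟩

theorem exists_isDynSep_card_eq (hf : Continuous f) (E : Set X) (n : ℕ) {ε : ℝ} (hε : 0 < ε) :
    ∃ S : Finset X, IsDynSep f E n ε ↑S ∧ S.card = sepCount f E n ε :=
  have hne : {k | ∃ S : Finset X, IsDynSep f E n ε ↑S ∧ S.card = k}.Nonempty :=
    ⟨0, ∅, ⟨by simp, by simp⟩, rfl⟩
  Nat.sSup_mem hne (bddAbove_card_isDynSep hf E n hε)

theorem one_le_sepCount (hf : Continuous f) {E : Set X} (hE : E.Nonempty) (n : ℕ) {ε : ℝ}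
    (hε : 0 < ε) : 1 ≤ sepCount f E n ε := by
  obtain ⟨x, hx⟩ := hE
  refine IsDynSep.card_le_sepCount hf hε (S := {x}) ⟨by simpa using hx, fun a ha b hb hab => ?_⟩
  simp only [Finset.coe_singleton, mem_singleton_iff] at ha hb
  exact absurd (ha.trans hb.symm) hab

theorem sepCount_mono (hf : Continuous f) {E F : Set X} (hEF : E ⊆ F) (n : ℕ) {ε : ℝ}
    (hε : 0 < ε) : sepCount f E n ε ≤ sepCount f F n ε := by
  obtain ⟨S, hS, hcard⟩ := exists_isDynSep_card_eq hf E n hε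
  rw [← hcard]
  exact IsDynSep.card_le_sepCount hf hε ⟨hS.1.trans hEF, hS.2⟩

theorem exists_frequently_large_isDynSep [Nonempty X] (hf : Continuous f) {r : ℝ}
    (hr : (r : EReal) < topEnt f univ) :
    ∃ ε > 0, ∀ N : ℕ, ∃ n ≥ N, ∃ S : Finset X, IsDynSep f univ n ε ↑S ∧
      Real.exp (r * n) ≤ S.card := by
  simp only [topEnt, compactEnt, lt_iSup_iff] at hr
  obtain ⟨E, -, -, ε, hε, hr⟩ := hr
  refine ⟨ε, hε, fun N => ?_⟩
  obtain ⟨n, hn, hlt⟩ := frequently_atTop.1 (frequently_lt_of_lt_limsup (by isBoundedDefault) hr)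
    (N + 1)
  refine ⟨n, by omega, ?_⟩
  obtain ⟨S, hS, hcard⟩ := exists_isDynSep_card_eq hf univ n hε
  refine ⟨S, hS, ?_⟩
  rw [hcard]
  have hn0 : (0 : ℝ) < n := by exact_mod_cast (by omega)
  have hlt' : r < Real.log (sepCount f E n ε) / n := by exact_mod_cast hlt
  rw [lt_div_iff₀ hn0] at hlt'
  have h1 : (1 : ℝ) ≤ sepCount f univ n ε := by exact_mod_cast one_le_sepCount hf univ_nonempty n hε
  have h2 : (sepCount f E n ε : ℝ) ≤ sepCount f univ n ε := by
    exact_mod_cast sepCount_mono hf (subset_univ E) n hε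
  rw [← Real.le_log_iff_exp_le (by linarith)]
  refine hlt'.le.trans ?_
  rcases Nat.eq_zero_or_pos (sepCount f E n ε) with h0 | h0
  · rw [h0]; simpa using Real.log_nonneg h1
  · exact Real.log_le_log (by exact_mod_cast h0) h2

/-- Disjoint closed Bowen balls of orders at least `N` have total weight bounded by the tail of
the series of weighted separated-set cardinalities. -/
theorem packPre_le_tsum (hf : Continuous f) {ε : ℝ} (hε : 0 < ε) (t : ℝ) (N : ℕ) (E : Set X) :
    packPre f t N ε E ≤
      ∑' n : ℕ, ENNReal.ofReal (Real.exp (-t * (n + N : ℕ)) * sepCount f univ (n + N) ε) := by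
  classical
  refine iSup_le fun D => iSup_le fun _ => iSup_le fun hD => iSup_le fun hdisj => ?_
  rw [ENNReal.tsum_eq_iSup_sum]
  refine iSup_le fun F => ?_
  have hord : ∀ p : D, N ≤ (p : X × ℕ).2 := fun p => (hD p p.2).2
  set u : ℕ → ℝ≥0∞ := fun n =>
    ENNReal.ofReal (Real.exp (-t * (n + N : ℕ)) * sepCount f univ (n + N) ε) with hu
  have hfib : ∀ n, ∑ p ∈ F.filter (fun p : D => (p : X × ℕ).2 - N = n),
      ENNReal.ofReal (Real.exp (-t * ((p : X × ℕ).2 : ℝ))) ≤ u n := by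
    intro n
    have hmem : ∀ p ∈ F.filter fun p : D => (p : X × ℕ).2 - N = n, (p : X × ℕ).2 = n + N :=
      fun p hp => by
        have := (Finset.mem_filter.1 hp).2
        have := hord p
        omega
    rw [Finset.sum_congr rfl fun p hp => by rw [hmem p hp], Finset.sum_const, nsmul_eq_mul]
    simp only [hu]
    rw [mul_comm (Real.exp _), ENNReal.ofReal_mul (by positivity), ENNReal.ofReal_natCast]
    gcongr
    have hsep : ∀ p ∈ F.filter (fun p : D => (p : X × ℕ).2 - N = n),
        ∀ q ∈ F.filter (fun p : D => (p : X × ℕ).2 - N = n), p ≠ q →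
          ∃ i < n + N, ε < dist (f^[i] (p : X × ℕ).1) (f^[i] (q : X × ℕ).1) := by
      intro p hp q hq hpq
      by_contra! hcon
      have hpqd := Set.disjoint_left.1 (hdisj p.2 q.2 fun h => hpq (Subtype.ext h))
      refine hpqd (a := (q : X × ℕ).1) (fun i hi => hcon i (by rwa [← hmem p hp])) fun i _ => ?_
      rw [dist_self]
      exact hε.le
    have hinj : Set.InjOn (fun p : D => (p : X × ℕ).1)
        (F.filter fun p : D => (p : X × ℕ).2 - N = n) := by
      intro p hp q hq hpq
      by_contra hne
      obtain ⟨i, -, hi⟩ := hsep p hp q hq hne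
      have hpq' : (p : X × ℕ).1 = (q : X × ℕ).1 := hpq
      rw [hpq', dist_self] at hi
      exact absurd hi (not_lt.2 hε.le)
    rw [← Finset.card_image_of_injOn hinj]
    refine IsDynSep.card_le_sepCount hf hε ⟨subset_univ _, fun x hx y hy hxy => ?_⟩
    obtain ⟨p, hp, rfl⟩ := Finset.mem_image.1 hx
    obtain ⟨q, hq, rfl⟩ := Finset.mem_image.1 hy
    exact hsep p hp q hq fun h => hxy (by rw [h])
  calc ∑ p ∈ F, ENNReal.ofReal (Real.exp (-t * ((p : X × ℕ).2 : ℝ)))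
      = ∑ n ∈ F.image (fun p : D => (p : X × ℕ).2 - N), ∑ p ∈ F.filter (fun p : D => (p : X × ℕ).2 - N = n),
          ENNReal.ofReal (Real.exp (-t * ((p : X × ℕ).2 : ℝ))) :=
        (Finset.sum_fiberwise_of_maps_to (fun p hp => Finset.mem_image_of_mem _ hp) _).symm
    _ ≤ ∑ n ∈ F.image (fun p : D => (p : X × ℕ).2 - N), u n := Finset.sum_le_sum fun n _ => hfib n
    _ ≤ ∑' n, u n := ENNReal.sum_le_tsum _

theorem packEnt_le_topEnt (hf : Continuous f) (Y : Set X) : packEnt f Y ≤ topEnt f univ := by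
  refine iSup_le fun ε => iSup_le fun hε => ?_
  refine EReal.le_of_forall_lt_iff_le.1 fun t ht => ?_
  obtain ⟨t₁, ht₁, ht₁t⟩ := EReal.lt_iff_exists_real_btwn.1 ht
  have ht₁t' : t₁ < t := by exact_mod_cast ht₁t
  refine sInf_le ⟨t, rfl, ?_⟩
  have hlim : limsup (fun n : ℕ => ((Real.log (sepCount f univ n ε) / n : ℝ) : EReal)) atTop < t₁ := by
    refine lt_of_le_of_lt ?_ ht₁
    exact (le_iSup₂ (f := fun (ε : ℝ) (_ : 0 < ε) =>
      limsup (fun n : ℕ => ((Real.log (sepCount f univ n ε) / n : ℝ) : EReal)) atTop) ε hε).trans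
      (le_iSup_of_le univ (le_iSup_of_le isCompact_univ (le_iSup_of_le subset_rfl le_rfl)))
  obtain ⟨N₀, hN₀⟩ := eventually_atTop.1 (eventually_lt_of_limsup_lt hlim)
  have hsep : ∀ n ≥ N₀ + 1, (sepCount f univ n ε : ℝ) ≤ Real.exp (t₁ * n) := fun n hn => by
    rcases Nat.eq_zero_or_pos (sepCount f univ n ε) with h0 | h0
    · rw [h0]; simpa using (Real.exp_pos _).le
    have hn0 : (0 : ℝ) < n := by exact_mod_cast (by omega)
    have h1 : Real.log (sepCount f univ n ε) / n < t₁ := by exact_mod_cast hN₀ n (by omega)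
    rw [div_lt_iff₀ hn0] at h1
    exact (Real.log_le_iff_le_exp (by exact_mod_cast h0)).1 h1.le
  set v : ℕ → ℝ≥0∞ := fun n => ENNReal.ofReal (Real.exp (n * (t₁ - t))) with hv
  have hvsum : ∑' n, v n ≠ ⊤ := by
    have h1 : Summable fun n : ℕ => Real.exp (n * (t₁ - t)) :=
      Real.summable_exp_nat_mul_iff.2 (by linarith)
    rw [hv, ← ENNReal.ofReal_tsum_of_nonneg (fun _ => (Real.exp_pos _).le) h1]
    exact ENNReal.ofReal_ne_top
  have hpre : packPreLim f t ε univ = 0 := by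
    have htend := ENNReal.tendsto_sum_nat_add v hvsum
    refine le_antisymm (le_of_tendsto_of_tendsto tendsto_const_nhds htend ?_) zero_le
    filter_upwards [eventually_ge_atTop (N₀ + 1)] with N hN
    refine (iInf_le _ N).trans ((packPre_le_tsum hf hε t N univ).trans
      (ENNReal.tsum_le_tsum fun n => ENNReal.ofReal_le_ofReal ?_))
    calc Real.exp (-t * (n + N : ℕ)) * sepCount f univ (n + N) ε
        ≤ Real.exp (-t * (n + N : ℕ)) * Real.exp (t₁ * (n + N : ℕ)) := by
          gcongr; exact hsep _ (by omega)
      _ = Real.exp ((n + N : ℕ) * (t₁ - t)) := by rw [← Real.exp_add]; ring_nf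
  refine le_antisymm ((iInf₂_le (fun _ => univ) (subset_iUnion_of_subset 0 (subset_univ Y))).trans ?_)
    zero_le
  simp [hpre]

end SeparatedSets

section Horseshoe

variable {X : Type*} {m : ℕ}

/-- Ever longer blocks of fast growth, alternating with blocks of slow growth, force the maximal
Lyapunov exponent not to exist. -/
theorem mem_MLIrr_of_blocks [NeZero m] {f : X → X} {A : X → (Em m ≃L[ℝ] Em m)} {M : ℝ}
    (hM : LogBounded A M) {x : X} {χ₁ χ₂ θ : ℝ} (hχ : χ₂ < χ₁) (hθ : 0 < θ)
    (hhigh : ∀ N : ℕ, ∃ T n j : ℕ, N ≤ n ∧ N * T ≤ n ∧ n ≤ 2 * j ∧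
      χ₁ * j ≤ logGrowth f A (f^[T] x) j)
    (hlow : ∀ N : ℕ, ∃ T ≥ N, ∃ n : ℕ, θ * T ≤ n ∧ logGrowth f A (f^[T] x) n ≤ χ₂ * n) :
    x ∈ MLIrr f A := by
  obtain ⟨χ, hχ2, hχ1⟩ := exists_between hχ
  refine mem_MLIrr_of_growth (f := f) (A := A) (χ₁ := χ) hχ2 hθ (fun N => ?_) fun N => ?_
  · obtain ⟨K, hK⟩ := exists_nat_ge (2 * (|M| + |χ|) / (χ₁ - χ))
    obtain ⟨T, n, j, h1, h2, h3, h4⟩ := hhigh (2 * N + K)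
    refine ⟨T + j, by omega, ?_⟩
    have h5 := logGrowth_shift_le (f := f) hM x T j
    have hpos : 0 < χ₁ - χ := by linarith
    rw [div_le_iff₀ hpos] at hK
    have h6 : (K : ℝ) * T ≤ 2 * j := by
      have : K * T ≤ 2 * j := by nlinarith
      exact_mod_cast this
    have h7 : (|M| + |χ|) * T ≤ (χ₁ - χ) * j := by
      nlinarith [mul_le_mul_of_nonneg_right hK (Nat.cast_nonneg (α := ℝ) T)]
    have h8 : M * T ≤ |M| * T := by gcongr; exact le_abs_self M
    have h9 : χ * T ≤ |χ| * T := by gcongr; exact le_abs_self χ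
    push_cast
    linarith
  · obtain ⟨T, hT, n, hn, h⟩ := hlow N
    exact ⟨T, hT, n, hn, (logGrowth_add_le hM x T n).trans (by linarith)⟩

variable [MetricSpace X]

theorem isClosed_setOf_follows {f : X → X} (hf : Continuous f) (τ lam : ℝ) (N : ℕ) (z : X) :
    IsClosed {y | Follows f τ lam N z y} := by
  simp only [Follows, ofPred_forall]
  exact isClosed_iInter fun l => isClosed_iInter fun _ =>
    isClosed_le ((hf.iterate l).dist continuous_const) continuous_const

/-- The set `E` realizes all sequences of choices from the large separated sets `S k`, along
blocks of length `n k` starting at times `T k` that are negligible compared with `n k`. -/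
structure IsHorseshoe (f : X → X) (ε r : ℝ) (n T : ℕ → ℕ) (S : ℕ → Finset X) (E : Set X) :
    Prop where
  mul_start_le : ∀ k, k * T k ≤ n k
  le_length : ∀ k, k ≤ n k
  isDynSep : ∀ k, IsDynSep f univ (n k) ε ↑(S k)
  exp_le_card : ∀ k, Real.exp (r * n k) ≤ (S k).card
  exists_realization : ∀ ω : ℕ → X, (∀ k, ω k ∈ S k) → ∃ x ∈ E, ∀ k, ∀ l < n k,
    dist (f^[l] (f^[T k] x)) (f^[l] (ω k)) ≤ ε / 8

variable [CompactSpace X] [MeasurableSpace X] [BorelSpace X]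

theorem exists_irregular_horseshoe [NeZero m] {f : X ≃ X} (hf : Continuous f)
    (hmix : TopMixingOn (⇑f) univ) {lam : ℝ} (hlam : 0 < lam) (hs : ExpShadowingWith f lam)
    {A : X → (Em m ≃L[ℝ] Em m)} (hA : HolderMat A)
    (μ ν : Measure X) [IsProbabilityMeasure μ] [IsProbabilityMeasure ν]
    (hμ : MeasurePreserving f μ μ) (hν : MeasurePreserving f ν ν)
    (hlt : mle f A ν < mle f A μ) {ε r : ℝ} (hε : 0 < ε)
    (hsep : ∀ N : ℕ, ∃ n ≥ N, ∃ S : Finset X, IsDynSep f univ n ε ↑S ∧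
      Real.exp (r * n) ≤ S.card) :
    ∃ (n T : ℕ → ℕ) (S : ℕ → Finset X) (E : Set X), IsCompact E ∧ E ⊆ MLIrr f A ∧
      IsHorseshoe f ε r n T S E := by
  obtain ⟨M, -, hM⟩ := exists_logBounded hA.continuous
  obtain ⟨χ₂, hχν, hχ⟩ := exists_between hlt
  obtain ⟨χ₁, hχ₂₁, hχμ⟩ := exists_between hχ
  obtain ⟨τ₁, hτ₁, c, hc, N₁, hhigh⟩ := exists_high_growth_set hf hA hlam μ hμ hχμ
  obtain ⟨τ₂, hτ₂, N₂, hlow⟩ := exists_low_growth_point hf hA ν hν hχν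
  set τ := min (ε / 8) (min τ₁ τ₂) with hτdef
  have hτ : 0 < τ := by positivity
  have hτε : τ ≤ ε / 8 := min_le_left _ _
  have hττ₁ : τ ≤ τ₁ := (min_le_right _ _).trans (min_le_left _ _)
  have hττ₂ : τ ≤ τ₂ := (min_le_right _ _).trans (min_le_right _ _)
  obtain ⟨g, hg⟩ := exists_gluing hmix hs hτ
  obtain ⟨n, T, hT0, hT, hn, hQ⟩ := exists_schedule g
    (Q := fun k T n => k * T ≤ n ∧ k ≤ n ∧ ∃ S : Finset X, S.Nonempty ∧
      (k % 3 = 0 → IsDynSep f univ n ε ↑S ∧ Real.exp (r * n) ≤ S.card) ∧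
      (k % 3 = 1 → ∀ z ∈ S, ∃ j ≤ n, n ≤ 2 * j ∧
        ∀ y, Follows f τ₁ lam n z y → χ₁ * j ≤ logGrowth f A y j) ∧
      (k % 3 = 2 → ∀ z ∈ S, ∀ y, (∀ l < n, dist (f^[l] y) (f^[l] z) ≤ τ₂) →
        logGrowth f A y n ≤ χ₂ * n)) (by
    intro k T
    obtain h | h | h : k % 3 = 0 ∨ k % 3 = 1 ∨ k % 3 = 2 := by omega
    · obtain ⟨n, hn, S, hS, hcard⟩ := hsep (k * T + k + 1)
      refine ⟨n, by omega, by omega, by omega, S, ?_, fun _ => ⟨hS, hcard⟩, by omega, by omega⟩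
      rw [← Finset.card_pos]
      exact_mod_cast (Real.exp_pos _).trans_le hcard
    · obtain ⟨H, -, hcH, hH⟩ := hhigh (k * T + k + 1 + N₁) (by omega)
      have hne : H.Nonempty := by
        by_contra hne
        rw [not_nonempty_iff_eq_empty] at hne
        rw [hne, measureReal_empty] at hcH
        linarith
      obtain ⟨z, hz⟩ := hne
      refine ⟨k * T + k + 1 + N₁, by omega, by omega, by omega, {z}, by simp, by omega, fun _ w hw => ?_,
        by omega⟩
      rw [Finset.mem_singleton.1 hw]
      exact hH z hz
    · obtain ⟨z, hz⟩ := hlow (k * T + k + 1 + N₂) (by omega)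
      refine ⟨k * T + k + 1 + N₂, by omega, by omega, by omega, {z}, by simp, by omega, by omega,
        fun _ w hw => ?_⟩
      rw [Finset.mem_singleton.1 hw]
      exact hz)
  choose hkT hkn S hSne hS0 hS1 hS2 using hQ
  have hidx : ∀ k, 3 * k % 3 = 0 := fun k => by omega
  refine ⟨fun k => n (3 * k), fun k => T (3 * k), fun k => S (3 * k),
    {x | ∀ j, ∃ s ∈ S j, Follows f τ lam (n j) s (f^[T j] x)}, ?_, fun x hx => ?_,
    fun k => (Nat.mul_le_mul_right _ (by omega)).trans (hkT (3 * k)),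
    fun k => le_trans (by omega) (hkn (3 * k)), fun k => (hS0 _ (hidx k)).1,
    fun k => (hS0 _ (hidx k)).2, fun ω hω => ?_⟩
  · refine IsClosed.isCompact ?_
    rw [ofPred_forall]
    refine isClosed_iInter fun j => ?_
    have : {x | ∃ s ∈ S j, Follows f τ lam (n j) s (f^[T j] x)} =
        ⋃ s ∈ S j, (f^[T j]) ⁻¹' {y | Follows f τ lam (n j) s y} := by
      ext; simp
    rw [this]
    exact (S j).finite_toSet.isClosed_biUnion fun s _ =>
      (isClosed_setOf_follows hf τ lam (n j) s).preimage (hf.iterate _)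
  · refine mem_MLIrr_of_blocks hM hχ₂₁ one_pos (fun N => ?_) fun N => ?_
    · obtain ⟨s, hs, hfol⟩ := hx (3 * N + 1)
      obtain ⟨j, -, hj2, hj⟩ := hS1 (3 * N + 1) (by omega) s hs
      exact ⟨T (3 * N + 1), n (3 * N + 1), j, le_trans (by omega) (hkn _),
        (Nat.mul_le_mul_right _ (by omega)).trans (hkT (3 * N + 1)), hj2, hj _ (hfol.mono hττ₁)⟩
    · obtain ⟨s, hs, hfol⟩ := hx (3 * N + 2)
      refine ⟨T (3 * N + 2), le_trans (by omega) (le_of_schedule hT hn (3 * N + 2)),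
        n (3 * N + 2), ?_, hS2 (3 * N + 2) (by omega) s hs _
          fun l hl => (hfol.dist_le hτ.le hlam.le hl).trans hττ₂⟩
      rw [one_mul]
      exact_mod_cast (Nat.le_mul_of_pos_left _ (by omega)).trans (hkT (3 * N + 2))
  · choose e he using hSne
    obtain ⟨p, hp⟩ := hg (fun j => if j % 3 = 0 then ω (j / 3) else e j) n T hn hT0 hT
    refine ⟨p, fun j => ?_, fun k l hl => ?_⟩
    · refine ⟨_, ?_, hp j⟩
      split_ifs with h
      · have : ω (j / 3) ∈ S (3 * (j / 3)) := hω (j / 3)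
        rwa [show 3 * (j / 3) = j by omega] at this
      · exact he j
    · have h1 := (hp (3 * k)).dist_le hτ.le hlam.le hl
      simp only [hidx, if_true, show 3 * k / 3 = k by omega] at h1
      exact h1.trans hτε

end Horseshoe

namespace IsHorseshoe

variable {X : Type*} [MetricSpace X] {f : X → X} {ε r t : ℝ} {n T : ℕ → ℕ} {S : ℕ → Finset X}
  {E Y : Set X}

theorem nonempty (h : IsHorseshoe f ε r n T S E) (k : ℕ) : (S k).Nonempty := by
  rw [← Finset.card_pos]
  exact_mod_cast (Real.exp_pos _).trans_le (h.exp_le_card k)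

theorem eventually_exp_le (h : IsHorseshoe f ε r n T S E) (ht : t < r) :
    ∀ᶠ k in atTop, Real.exp (t * (T k + n k : ℕ)) ≤ (S k).card := by
  obtain ⟨K, hK⟩ := exists_nat_ge (|t| / (r - t))
  filter_upwards [eventually_ge_atTop K] with k hk
  refine (Real.exp_le_exp.2 ?_).trans (h.exp_le_card k)
  have hrt : 0 < r - t := by linarith
  have hk' : |t| ≤ k * (r - t) := by
    rw [← div_le_iff₀ hrt]
    exact hK.trans (by exact_mod_cast hk)
  have h1 : (k : ℝ) * T k ≤ n k := by exact_mod_cast h.mul_start_le k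
  have h2 : t * T k ≤ |t| * T k := by gcongr; exact le_abs_self t
  have h3 : |t| * T k ≤ k * (r - t) * T k := by gcongr
  push_cast
  nlinarith

theorem exists_lt_dist (h : IsHorseshoe f ε r n T S E) {k : ℕ} {x y s s' : X} (hs : s ∈ S k)
    (hs' : s' ∈ S k) (hne : s ≠ s')
    (hx : ∀ l < n k, dist (f^[l] (f^[T k] x)) (f^[l] s) ≤ ε / 8)
    (hy : ∀ l < n k, dist (f^[l] (f^[T k] y)) (f^[l] s') ≤ ε / 8) :
    ∃ i < T k + n k, 3 * ε / 4 < dist (f^[i] x) (f^[i] y) := by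
  obtain ⟨l, hl, hd⟩ := (h.isDynSep k).2 s hs s' hs' hne
  refine ⟨l + T k, by omega, ?_⟩
  have h1 := hx l hl
  have h2 := hy l hl
  rw [← Function.iterate_add_apply] at h1 h2
  rw [dist_comm] at h1
  linarith [dist_triangle4 (f^[l] s) (f^[l + T k] x) (f^[l + T k] y) (f^[l] s')]

theorem le_compactEnt [CompactSpace X] (hf : Continuous f) (h : IsHorseshoe f ε r n T S E)
    (hε : 0 < ε) (ht : t < r) : (t : EReal) ≤ compactEnt f E := by
  classical
  refine le_iSup₂_of_le (ε / 2) (half_pos hε) (le_limsup_of_frequently_le ?_)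
  refine frequently_atTop.2 fun N => ?_
  obtain ⟨k, hk, hkN⟩ := ((h.eventually_exp_le ht).and (eventually_ge_atTop (N + 1))).exists
  have hkn := h.le_length k
  refine ⟨T k + n k, by omega, ?_⟩
  choose e he using h.nonempty
  have hreal : ∀ s : S k, ∃ x ∈ E, ∀ l < n k,
      dist (f^[l] (f^[T k] x)) (f^[l] (s : X)) ≤ ε / 8 := fun s => by
    obtain ⟨x, hxE, hx⟩ := h.exists_realization (Function.update e k s) fun j => by
      rcases eq_or_ne j k with rfl | hj
      · simp
      · simpa [hj] using he j
    exact ⟨x, hxE, by simpa using hx k⟩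
  choose x hxE hx using hreal
  have hinj : Function.Injective x := fun s s' hss => by
    by_contra hne
    obtain ⟨i, -, hi⟩ := h.exists_lt_dist s.2 s'.2 (fun h => hne (Subtype.ext h)) (hx s) (hx s')
    rw [hss, dist_self] at hi
    linarith
  have hcard : (S k).card ≤ sepCount f E (T k + n k) (ε / 2) := by
    rw [← Fintype.card_coe, ← Finset.card_univ, ← Finset.card_image_of_injective _ hinj]
    refine IsDynSep.card_le_sepCount hf (half_pos hε) ⟨?_, ?_⟩
    · intro y hy
      obtain ⟨s, -, rfl⟩ := Finset.mem_image.1 hy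
      exact hxE s
    · intro y hy z hz hyz
      obtain ⟨s, -, rfl⟩ := Finset.mem_image.1 hy
      obtain ⟨s', -, rfl⟩ := Finset.mem_image.1 hz
      obtain ⟨i, hi, hd⟩ := h.exists_lt_dist s.2 s'.2
        (fun h => hyz (by rw [Subtype.ext h])) (hx s) (hx s')
      exact ⟨i, hi, by linarith⟩
  have hpos : (0 : ℝ) < (T k + n k : ℕ) := by exact_mod_cast (by omega)
  have hle : Real.exp (t * (T k + n k : ℕ)) ≤ sepCount f E (T k + n k) (ε / 2) :=
    hk.trans (by exact_mod_cast hcard)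
  rw [EReal.coe_le_coe_iff, le_div_iff₀ hpos,
    Real.le_log_iff_exp_le ((Real.exp_pos _).trans_le hle)]
  exact hle

theorem le_packEnt (h : IsHorseshoe f ε r n T S E) (hEY : E ⊆ Y) (hε : 0 < ε) (ht : t < r) :
    (t : EReal) ≤ packEnt f Y := by
  classical
  refine le_iSup₂_of_le (ε / 4) (by positivity) (le_sInf ?_)
  rintro _ ⟨t', rfl, hzero⟩
  by_contra! hlt
  have ht' : t' < r := lt_trans (by exact_mod_cast hlt) ht
  obtain ⟨C, hC⟩ := iInf_lt_iff.1 (hzero.trans_lt one_pos : packMeas f t' (ε / 4) Y < 1)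
  obtain ⟨hYC, hC⟩ := iInf_lt_iff.1 hC
  have hpre : ∀ i, ∃ N, packPre f t' N (ε / 4) (C i) < 1 := fun i =>
    iInf_lt_iff.1 ((ENNReal.le_tsum i).trans_lt hC)
  choose N hN using hpre
  have hreal : ∀ ω : (∀ k, S k), ∃ x ∈ E, ∀ k, ∀ l < n k,
      dist (f^[l] (f^[T k] x)) (f^[l] (ω k : X)) ≤ ε / 8 := fun ω =>
    h.exists_realization (fun k => ω k) fun k => (ω k).2
  choose x hxE hx using hreal
  have hne : Nonempty (∀ k, S k) := ⟨fun k => ⟨_, (h.nonempty k).choose_spec⟩⟩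
  obtain ⟨i, hi⟩ := nonempty_interior_of_iUnion_of_closed
    (f := fun i => closure {ω : ∀ k, S k | x ω ∈ C i}) (fun i => isClosed_closure)
    (eq_univ_of_forall fun ω => by
      obtain ⟨i, hi⟩ := mem_iUnion.1 (hYC (hEY (hxE ω)))
      exact mem_iUnion.2 ⟨i, subset_closure hi⟩)
  obtain ⟨ω₀, hω₀⟩ := hi
  obtain ⟨I, u, hu, hsub⟩ := isOpen_pi_iff.1 isOpen_interior ω₀ hω₀
  obtain ⟨k, ⟨hk, hkN⟩, hkI⟩ := ((h.eventually_exp_le ht').and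
    (eventually_ge_atTop (N i))).and (eventually_gt_atTop (I.sup id)) |>.exists
  have hkI' : k ∉ I := fun hmem => absurd (Finset.le_sup (f := id) hmem) (not_le.2 hkI)
  have hkn := h.le_length k
  have hhit : ∀ s : S k, ∃ ω : ∀ k, S k, x ω ∈ C i ∧ ω k = s := fun s => by
    have hmem : Function.update ω₀ k s ∈ closure {ω : ∀ k, S k | x ω ∈ C i} := by
      refine interior_subset (hsub fun j hj => ?_)
      have hjk : j ≠ k := fun h => hkI' (h ▸ hj)
      rw [Function.update_of_ne hjk]
      exact (hu j hj).2
    obtain ⟨ω, hω, hωC⟩ := mem_closure_iff.1 hmem ((fun ω : ∀ k, S k => ω k) ⁻¹' {s})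
      ((isOpen_discrete _).preimage (continuous_apply k)) (by simp)
    exact ⟨ω, hωC, hω⟩
  choose w hwC hw using hhit
  have hfar : ∀ s s' : S k, s ≠ s' →
      ∃ j < T k + n k, 3 * ε / 4 < dist (f^[j] (x (w s))) (f^[j] (x (w s'))) := fun s s' hss => by
    refine h.exists_lt_dist s.2 s'.2 (fun h => hss (Subtype.ext h)) ?_ ?_
    · simpa only [hw] using hx (w s) k
    · simpa only [hw] using hx (w s') k
  set φ : S k → X × ℕ := fun s => (x (w s), T k + n k) with hφ
  have hinj : Function.Injective φ := fun s s' hss => by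
    by_contra hne
    obtain ⟨j, -, hj⟩ := hfar s s' hne
    have hss' : x (w s) = x (w s') := (Prod.ext_iff.1 hss).1
    rw [hss', dist_self] at hj
    linarith
  have hge : (1 : ℝ≥0∞) ≤ packPre f t' (N i) (ε / 4) (C i) := by
    refine le_iSup_of_le (range φ) (le_iSup_of_le (countable_range φ) (le_iSup_of_le ?_
      (le_iSup_of_le ?_ ?_)))
    · rintro _ ⟨s, rfl⟩
      exact ⟨hwC s, by simp only [hφ]; omega⟩
    · rintro _ ⟨s, rfl⟩ _ ⟨s', rfl⟩ hss
      obtain ⟨j, hj, hd⟩ := hfar s s' fun h => hss (by rw [h])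
      refine Set.disjoint_left.2 fun y hy hy' => ?_
      have h1 := hy j hj
      have h2 := hy' j hj
      simp only [hφ] at h1 h2
      linarith [dist_triangle_right (f^[j] (x (w s))) (f^[j] (x (w s'))) (f^[j] y)]
    · rw [tsum_range (fun p : X × ℕ => ENNReal.ofReal (Real.exp (-t' * (p.2 : ℝ)))) hinj,
        tsum_fintype]
      simp only [hφ, Finset.sum_const, Finset.card_univ, Fintype.card_coe, nsmul_eq_mul]
      rw [← ENNReal.ofReal_natCast, ← ENNReal.ofReal_mul (by positivity), ENNReal.one_le_ofReal]
      calc (1 : ℝ) = Real.exp (t' * (T k + n k : ℕ)) * Real.exp (-t' * (T k + n k : ℕ)) := by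
            rw [← Real.exp_add]; simp
        _ ≤ _ := by gcongr
  exact absurd (hN i) (not_lt.2 hge)

end IsHorseshoe

section MassDistribution

variable {X : Type*} [MetricSpace X]

/-- The mass distribution principle for the Bowen–Hausdorff entropy. The parametrization `x` of
the points need not be measurable. -/
theorem le_bowenEnt_of_measure {Ω : Type*} [MeasurableSpace Ω] (P : Measure Ω)
    [IsProbabilityMeasure P] {f : X → X} {E : Set X} {x : Ω → X} (hx : ∀ᵐ ω ∂P, x ω ∈ E)
    {t σ C : ℝ} (hσ : 0 < σ) {N : ℕ}
    (hball : ∀ y, ∀ u ≥ N, P.real {ω | x ω ∈ dynBall f y u σ} ≤ C * Real.exp (-t * u)) :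
    (t : EReal) ≤ bowenEnt f E := by
  refine le_iSup₂_of_le σ hσ (le_sInf ?_)
  rintro _ ⟨t', rfl, hzero⟩
  by_contra! hlt
  have htt : t' < t := by exact_mod_cast hlt
  have hpos : (0 : ℝ≥0∞) < (ENNReal.ofReal (max C 1))⁻¹ :=
    ENNReal.inv_pos.2 ENNReal.ofReal_ne_top
  have hCn : bowenCn f E t' σ N < (ENNReal.ofReal (max C 1))⁻¹ :=
    (le_iSup (fun n => bowenCn f E t' σ n) N).trans_lt (hzero.trans_lt hpos)
  simp only [bowenCn, iInf_lt_iff] at hCn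
  obtain ⟨s, hs, hord, hcov, hsum⟩ := hCn
  have hlt1 : ENNReal.ofReal (max C 1) * bowenSum t' s < 1 := by
    rw [mul_comm]
    exact ENNReal.mul_lt_of_lt_div (by rwa [one_div])
  refine absurd hlt1 (not_lt.2 ?_)
  have : Countable s := hs.to_subtype
  calc (1 : ℝ≥0∞) = P univ := measure_univ.symm
    _ ≤ P (⋃ p : s, {ω | x ω ∈ dynBall f (p : X × ℕ).1 (p : X × ℕ).2 σ}) := by
        refine measure_mono_ae ?_
        filter_upwards [hx] with ω hω _
        obtain ⟨p, hp, hmem⟩ := mem_iUnion₂.1 (hcov hω)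
        exact mem_iUnion.2 ⟨⟨p, hp⟩, hmem⟩
    _ ≤ ∑' p : s, P {ω | x ω ∈ dynBall f (p : X × ℕ).1 (p : X × ℕ).2 σ} := measure_iUnion_le _
    _ ≤ ∑' p : s, ENNReal.ofReal (max C 1) *
          ENNReal.ofReal (Real.exp (-t' * ((p : X × ℕ).2 : ℝ))) := by
        refine ENNReal.tsum_le_tsum fun p => ?_
        rw [← ENNReal.ofReal_mul (by positivity), ← ofReal_measureReal]
        refine ENNReal.ofReal_le_ofReal ((hball _ _ (hord p p.2)).trans ?_)
        gcongr
        exact le_max_left C 1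
    _ = ENNReal.ofReal (max C 1) * bowenSum t' s := ENNReal.tsum_mul_left

variable [MeasurableSpace X]

/-- Conditioning on a subset of a set of points whose Bowen balls are small yields a measure for
which all Bowen balls are small. -/
theorem cond_dynBall_le {f : X → X} {μ : Measure X} [IsProbabilityMeasure μ] {s σ c : ℝ}
    (hs : 0 ≤ s) (hc : 0 < c) {n₀ : ℕ} {K : Set X} (hK : MeasurableSet K) (hcK : c ≤ μ.real K)
    (hball : ∀ x ∈ K, ∀ n ≥ n₀, μ.real (dynBall f x n σ) ≤ Real.exp (-s * n)) (y : X) (u : ℕ) :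
    (ProbabilityTheory.cond μ K).real (dynBall f y u (σ / 2)) ≤
      c⁻¹ * Real.exp (s * n₀) * Real.exp (-s * u) := by
  have hc1 : 1 ≤ c⁻¹ := (one_le_inv₀ hc).2 (hcK.trans measureReal_le_one)
  have hn₀ : 1 ≤ Real.exp (s * n₀) := Real.one_le_exp (by positivity)
  rcases lt_or_ge u n₀ with hu | hu
  · refine measureReal_le_one.trans ?_
    rw [mul_assoc, ← Real.exp_add]
    refine one_le_mul_of_one_le_of_one_le hc1 (Real.one_le_exp ?_)
    have : (u : ℝ) ≤ n₀ := by exact_mod_cast hu.le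
    nlinarith
  have hμK : μ.real (K ∩ dynBall f y u (σ / 2)) ≤ Real.exp (-s * u) := by
    rcases (K ∩ dynBall f y u (σ / 2)).eq_empty_or_nonempty with h | ⟨z, hzK, hz⟩
    · rw [h, measureReal_empty]
      exact (Real.exp_pos _).le
    · refine (measureReal_mono fun w hw i hi => ?_).trans (hball z hzK u hu)
      linarith [hz i hi, hw.2 i hi, dist_triangle_left (f^[i] z) (f^[i] w) (f^[i] y)]
  rw [measureReal_def, ProbabilityTheory.cond_apply hK, ENNReal.toReal_mul, ENNReal.toReal_inv,
    ← measureReal_def, ← measureReal_def]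
  calc (μ.real K)⁻¹ * μ.real (K ∩ dynBall f y u (σ / 2)) ≤ c⁻¹ * Real.exp (-s * u) := by gcongr
    _ ≤ c⁻¹ * Real.exp (s * n₀) * Real.exp (-s * u) := by
        gcongr
        exact le_mul_of_one_le_right (by positivity) hn₀

variable [BorelSpace X]

/-- Bowen balls of the points that follow a random sequence of orbit segments are small if the
segments in even positions are distributed along measures with small Bowen balls. -/
theorem infinitePi_dynBall_le {f : X → X} (hf : Continuous f) {p : ℕ → Measure X}
    [∀ k, IsProbabilityMeasure (p k)] {n T : ℕ → ℕ} {g : ℕ} (hn : ∀ k, 1 ≤ n k)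
    (hT : ∀ k, T (k + 1) = T k + n k + g) {s t γ σ C : ℝ} (hs : 0 ≤ s) (hγ : 0 < γ)
    (hts : t * (1 + γ) ≤ s) (hTn : ∀ k, (T (2 * k + 2) : ℝ) ≤ (1 + γ) * n (2 * k))
    (hball : ∀ k y u, (p (2 * k)).real (dynBall f y u (σ / 2)) ≤ C * Real.exp (-s * u))
    {x : (ℕ → X) → X}
    (hx : ∀ ω k, ∀ l < n k, dist (f^[l] (f^[T k] (x ω))) (f^[l] (ω k)) ≤ σ / 4)
    (y : X) (u : ℕ) (hu : T 2 ≤ u) :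
    (Measure.infinitePi p).real {ω | x ω ∈ dynBall f y u (σ / 4)} ≤
      C ^ 2 * Real.exp (-t * u) := by
  have hex : ∃ k, u < T (2 * k + 2) := ⟨u, lt_of_lt_of_le (by omega) (le_of_schedule hT hn _)⟩
  obtain ⟨k, hk, hk'⟩ : ∃ k, T (2 * k + 2) ≤ u ∧ u < T (2 * k + 4) := by
    classical
    obtain ⟨j, hj⟩ : ∃ j, Nat.find hex = j + 1 := by
      refine Nat.exists_eq_succ_of_ne_zero fun h => ?_
      have := Nat.find_spec hex
      rw [h] at this
      exact absurd hu (not_le.2 this)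
    refine ⟨j, not_lt.1 (Nat.find_min hex (by omega)), ?_⟩
    have := Nat.find_spec hex
    rwa [hj] at this
  set v := min (n (2 * k + 2)) (u - T (2 * k + 2)) with hv
  set B : ℕ → Set X := fun j => if j = 2 * k then dynBall f (f^[T (2 * k)] y) (n (2 * k)) (σ / 2)
    else dynBall f (f^[T (2 * k + 2)] y) v (σ / 2) with hB
  have hB0 : B (2 * k) = dynBall f (f^[T (2 * k)] y) (n (2 * k)) (σ / 2) := by simp [hB]
  have hB1 : B (2 * k + 2) = dynBall f (f^[T (2 * k + 2)] y) v (σ / 2) := by simp [hB]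
  have hT1 := hT (2 * k)
  have hT2 := hT (2 * k + 1)
  have hT2' : T (2 * k + 2) = T (2 * k + 1) + n (2 * k + 1) + g := hT2
  have hnear : ∀ ω, x ω ∈ dynBall f y u (σ / 4) → ∀ j l, l < n j → T j + l < u →
      dist (f^[l] (f^[T j] y)) (f^[l] (ω j)) < σ / 2 := fun ω hω j l hl hlu => by
    have h1 := hω (l + T j) (by omega)
    have h2 := hx ω j l hl
    rw [Function.iterate_add_apply, Function.iterate_add_apply] at h1
    linarith [dist_triangle (f^[l] (f^[T j] y)) (f^[l] (f^[T j] (x ω))) (f^[l] (ω j))]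
  have hsub : {ω | x ω ∈ dynBall f y u (σ / 4)} ⊆
      Set.pi (({2 * k, 2 * k + 2} : Finset ℕ) : Set ℕ) B := by
    intro ω hω j hj
    simp only [Finset.coe_insert, Finset.coe_singleton, mem_insert_iff, mem_singleton_iff] at hj
    rcases hj with rfl | rfl
    · rw [hB0]
      exact fun l hl => hnear ω hω _ l hl (by omega)
    · rw [hB1]
      exact fun l hl => hnear ω hω _ l (by omega) (by omega)
  have hmeas : ∀ j ∈ ({2 * k, 2 * k + 2} : Finset ℕ), MeasurableSet (B j) := fun j _ => by
    simp only [hB]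
    split_ifs <;> exact (isOpen_dynBall hf _ _ _).measurableSet
  have hC : 0 ≤ C := by
    have := measureReal_nonneg.trans (hball 0 y 0)
    simpa using this
  have hpi : (Measure.infinitePi p).real (Set.pi (({2 * k, 2 * k + 2} : Finset ℕ) : Set ℕ) B) =
      (p (2 * k)).real (B (2 * k)) * (p (2 * k + 2)).real (B (2 * k + 2)) := by
    rw [measureReal_def, Measure.infinitePi_pi p hmeas, Finset.prod_pair (by omega),
      ENNReal.toReal_mul]
    rfl
  refine (measureReal_mono hsub).trans ?_
  rw [hpi, hB0, hB1]
  have huv : (u : ℝ) ≤ (1 + γ) * (n (2 * k) + v) := by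
    have hk0 := hTn k
    have hk1 : (T (2 * k + 4) : ℝ) ≤ (1 + γ) * n (2 * k + 2) := hTn (k + 1)
    rcases le_total (u - T (2 * k + 2)) (n (2 * k + 2)) with h | h
    · have : (u : ℝ) = T (2 * k + 2) + v := by exact_mod_cast (by omega)
      nlinarith [Nat.cast_nonneg (α := ℝ) v]
    · have hvn : (v : ℝ) = n (2 * k + 2) := by exact_mod_cast (by omega)
      have hu' : (u : ℝ) ≤ T (2 * k + 4) := by exact_mod_cast hk'.le
      nlinarith [Nat.cast_nonneg (α := ℝ) (n (2 * k))]
  calc _ ≤ C * Real.exp (-s * n (2 * k)) * (C * Real.exp (-s * v)) := by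
        gcongr
        · exact hball k _ _
        · exact hball (k + 1) _ _
    _ = C ^ 2 * Real.exp (-(s * (n (2 * k) + v))) := by
        rw [mul_mul_mul_comm, ← Real.exp_add, ← sq]
        ring_nf
    _ ≤ C ^ 2 * Real.exp (-t * u) := by
        gcongr
        have hw : (0 : ℝ) ≤ n (2 * k) + v := by positivity
        rcases le_total t 0 with h | h
        · nlinarith [Nat.cast_nonneg (α := ℝ) u, mul_nonneg hs hw]
        · nlinarith [mul_le_mul_of_nonneg_left huv h, mul_le_mul_of_nonneg_right hts hw]

end MassDistribution

section BowenEntropy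

variable {X : Type*} [MeasurableSpace X]

theorem mle_eq_zero_of_dim_eq_zero {f : X → X} (A : X → (Em 0 ≃L[ℝ] Em 0)) (μ : Measure X) :
    mle f A μ = 0 := by
  have : ∀ x n, cocycle f A x n = 0 := fun x n => Subsingleton.elim _ _
  simp [mle, this]

variable [MetricSpace X] [CompactSpace X] [BorelSpace X] {m : ℕ}

theorem exists_mle_lt_of_not_isLyapMin [NeZero m] {f : X → X} (hf : Continuous f)
    {A : X → (Em m ≃L[ℝ] Em m)} (hA : HolderMat A) {μ : Measure X} [IsProbabilityMeasure μ]
    (hμ : MeasurePreserving f μ μ) (hmin : ¬ IsLyapMin f A μ) :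
    ∃ ν : Measure X, IsProbabilityMeasure ν ∧ MeasurePreserving f ν ν ∧
      mle f A ν < mle f A μ := by
  obtain ⟨M, -, hM⟩ := exists_logBounded hA.continuous
  set R := {r : ℝ | ∃ ν : Measure X, IsProbabilityMeasure ν ∧ MeasurePreserving f ν ν ∧
    r = mle f A ν} with hR
  have hmem : mle f A μ ∈ R := ⟨μ, ‹_›, hμ, rfl⟩
  have hbdd : BddBelow R := by
    refine ⟨-M, ?_⟩
    rintro _ ⟨ν, hν, -, rfl⟩
    exact neg_le_mle hM hf hA.continuous ν
  have hlt : sInf R < mle f A μ := lt_of_le_of_ne (csInf_le hbdd hmem) fun h => hmin h.symm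
  obtain ⟨_, ⟨ν, h1, h2, rfl⟩, h3⟩ := exists_lt_of_csInf_lt ⟨_, hmem⟩ hlt
  exact ⟨ν, h1, h2, h3⟩

theorem ksEnt_le_bowenEnt_MLIrr [NeZero m] {f : X ≃ X} (hf : Continuous f)
    (hmix : TopMixingOn (⇑f) univ) {lam : ℝ} (hlam : 0 < lam) (hs : ExpShadowingWith f lam)
    {A : X → (Em m ≃L[ℝ] Em m)} (hA : HolderMat A)
    (μ ν : Measure X) [IsProbabilityMeasure μ] [IsProbabilityMeasure ν]
    (hμ : Ergodic f μ) (hν : MeasurePreserving f ν ν) (hlt : mle f A ν < mle f A μ) :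
    ksEnt f μ ≤ bowenEnt f (MLIrr f A) := by
  refine EReal.ge_of_forall_gt_iff_ge.1 fun t ht => ?_
  obtain ⟨s, hs0, hts, σ, hσ, hBK⟩ : ∃ s : ℝ, 0 ≤ s ∧ t < s ∧ ∃ σ > 0, ∀ δ > 0, ∃ n₀ : ℕ,
      ∃ G : Set X, MeasurableSet G ∧ μ.real Gᶜ ≤ δ ∧
        ∀ x ∈ G, ∀ n ≥ n₀, μ.real (dynBall f x n σ) ≤ Real.exp (-s * n) := by
    rcases lt_or_ge t 0 with ht0 | ht0
    · exact ⟨0, le_rfl, ht0, 1, one_pos, fun δ hδ => ⟨0, univ, MeasurableSet.univ,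
        by simpa using hδ.le, fun x _ n _ => by simp⟩⟩
    · obtain ⟨s, hts, hsh⟩ := EReal.lt_iff_exists_real_btwn.1 ht
      have hts' : t < s := by exact_mod_cast hts
      exact ⟨s, by linarith, hts', exists_large_set_measure_dynBall_le hf hμ hsh⟩
  obtain ⟨γ, hγ, hγs⟩ : ∃ γ > 0, t * (1 + γ) ≤ s := by
    have hts' : 0 < s - t := by linarith
    refine ⟨(s - t) / (|t| + 1), by positivity, ?_⟩
    have h1 : t * ((s - t) / (|t| + 1)) ≤ s - t := by
      rw [mul_div_assoc', div_le_iff₀ (by positivity)]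
      nlinarith [le_abs_self t]
    linarith
  obtain ⟨M, -, hM⟩ := exists_logBounded hA.continuous
  obtain ⟨χ₂, hχν, hχ⟩ := exists_between hlt
  obtain ⟨χ₁, hχ₂₁, hχμ⟩ := exists_between hχ
  obtain ⟨τ₁, hτ₁, c, hc, N₁, hhigh⟩ :=
    exists_high_growth_set hf hA hlam μ hμ.toMeasurePreserving hχμ
  obtain ⟨τ₂, hτ₂, N₂, hlow⟩ := exists_low_growth_point hf hA ν hν hχν
  obtain ⟨n₀, G, hGm, hGc, hG⟩ := hBK (c / 2) (half_pos hc)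
  set τ := min (σ / 4) (min τ₁ τ₂) with hτdef
  have hτ : 0 < τ := by positivity
  have hτσ : τ ≤ σ / 4 := min_le_left _ _
  have hττ₁ : τ ≤ τ₁ := (min_le_right _ _).trans (min_le_left _ _)
  have hττ₂ : τ ≤ τ₂ := (min_le_right _ _).trans (min_le_right _ _)
  set C := (c / 2)⁻¹ * Real.exp (s * n₀) with hC
  set θ := γ / 2 with hθdef
  have hθ : 0 < θ := by positivity
  obtain ⟨g, hg⟩ := exists_gluing hmix hs hτ
  obtain ⟨n, T, hT0, hT, hn, hQ⟩ := exists_schedule g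
    (Q := fun k T n => ∃ p : Measure X, IsProbabilityMeasure p ∧
      (k % 2 = 0 → k * T ≤ n ∧ k ≤ n ∧
        (1 + θ) * (T + n + g) + N₂ + 2 + g ≤ (1 + γ) * n ∧
        (∀ y u, p.real (dynBall f y u (σ / 2)) ≤ C * Real.exp (-s * u)) ∧
        ∀ᵐ z ∂p, ∃ j ≤ n, n ≤ 2 * j ∧
          ∀ y, Follows f τ₁ lam n z y → χ₁ * j ≤ logGrowth f A y j) ∧
      (k % 2 = 1 → θ * T ≤ n ∧ n ≤ θ * T + N₂ + 2 ∧
        ∀ᵐ z ∂p, ∀ y, (∀ l < n, dist (f^[l] y) (f^[l] z) ≤ τ₂) →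
          logGrowth f A y n ≤ χ₂ * n)) (by
    intro k T
    obtain h | h : k % 2 = 0 ∨ k % 2 = 1 := by omega
    · obtain ⟨L, hL⟩ := exists_nat_ge (((1 + θ) * (T + g) + N₂ + 2 + g) / θ)
      rw [div_le_iff₀ hθ] at hL
      obtain ⟨n, hnk, hnN, hnL, hn1⟩ : ∃ n, k * T + k ≤ n ∧ N₁ ≤ n ∧ L ≤ n ∧ 1 ≤ n :=
        ⟨k * T + k + N₁ + L + 1, by omega, by omega, by omega, by omega⟩
      obtain ⟨H, hHm, hcH, hH⟩ := hhigh n hnN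
      have hGH : c / 2 ≤ μ.real (H ∩ G) := by
        have h1 : μ.real H ≤ μ.real (H ∩ G) + μ.real Gᶜ := by
          refine (measureReal_mono (s₂ := (H ∩ G) ∪ Gᶜ) fun z hz => ?_).trans
            (measureReal_union_le _ _)
          by_cases hzG : z ∈ G
          exacts [Or.inl ⟨hz, hzG⟩, Or.inr hzG]
        linarith
      have hne : μ (H ∩ G) ≠ 0 := fun h0 => by
        rw [measureReal_def, h0, ENNReal.toReal_zero] at hGH
        linarith
      refine ⟨n, hn1, ProbabilityTheory.cond μ (H ∩ G),
        ProbabilityTheory.cond_isProbabilityMeasure hne, fun _ => ⟨by omega, by omega, ?_,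
          cond_dynBall_le hs0 (half_pos hc) (hHm.inter hGm) hGH fun x hx => hG x hx.2, ?_⟩,
        by omega⟩
      · have hnL' : (L : ℝ) ≤ n := by exact_mod_cast hnL
        have : γ = 2 * θ := by rw [hθdef]; ring
        rw [this]
        nlinarith
      · filter_upwards [ProbabilityTheory.ae_cond_mem (hHm.inter hGm)] with z hz
        exact hH z hz.1
    · obtain ⟨z, hz⟩ := hlow (⌈θ * T⌉₊ + N₂ + 1) (by omega)
      have h1 := Nat.le_ceil (θ * T)
      have h2 := Nat.ceil_lt_add_one (a := θ * T) (by positivity)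
      refine ⟨⌈θ * T⌉₊ + N₂ + 1, by omega, Measure.dirac z, inferInstance, by omega,
        fun _ => ⟨?_, ?_, ?_⟩⟩
      · push_cast
        linarith [Nat.cast_nonneg (α := ℝ) N₂]
      · push_cast
        linarith
      · rw [ae_dirac_eq]
        exact hz)
  choose p hp hev hodd using hQ
  have hx : ∀ ω : ℕ → X, ∃ x, ∀ k, Follows f τ lam (n k) (ω k) (f^[T k] x) := fun ω =>
    hg ω n T hn hT0 hT
  choose x hx using hx
  have heval : ∀ k (q : X → Prop), (∀ᵐ z ∂(p k), q z) →
      ∀ᵐ ω ∂(Measure.infinitePi p), q (ω k) := fun k q hq =>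
    (measurePreserving_eval_infinitePi p k).quasiMeasurePreserving.ae hq
  have hirr : ∀ᵐ ω ∂(Measure.infinitePi p), x ω ∈ MLIrr f A := by
    have h1 := ae_all_iff.2 fun k => heval (2 * k) _ (hev (2 * k) (by omega)).2.2.2.2
    have h2 := ae_all_iff.2 fun k => heval (2 * k + 1) _ (hodd (2 * k + 1) (by omega)).2.2
    filter_upwards [h1, h2] with ω hω1 hω2
    refine mem_MLIrr_of_blocks hM hχ₂₁ hθ (fun N => ?_) fun N => ?_
    · obtain ⟨j, -, hj2, hj⟩ := hω1 N
      obtain ⟨h3, h4, -⟩ := hev (2 * N) (by omega)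
      exact ⟨T (2 * N), n (2 * N), j, by omega, (Nat.mul_le_mul_right _ (by omega)).trans h3,
        hj2, hj _ ((hx ω (2 * N)).mono hττ₁)⟩
    · exact ⟨T (2 * N + 1), le_trans (by omega) (le_of_schedule hT hn (2 * N + 1)),
        n (2 * N + 1), (hodd (2 * N + 1) (by omega)).1,
        hω2 N _ fun l hl => ((hx ω _).dist_le hτ.le hlam.le hl).trans hττ₂⟩
  refine le_bowenEnt_of_measure (Measure.infinitePi p) hirr (σ := σ / 4) (C := C ^ 2)
    (by positivity) (N := T 2) fun y u hu => infinitePi_dynBall_le hf hn hT hs0 hγ hγs ?_ ?_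
      (fun ω k l hl => ((hx ω k).dist_le hτ.le hlam.le hl).trans hτσ) y u hu
  · intro k
    have h1 := (hev (2 * k) (by omega)).2.2.1
    have h2 := (hodd (2 * k + 1) (by omega)).2.1
    have h3 : T (2 * k + 2) = T (2 * k + 1) + n (2 * k + 1) + g := hT (2 * k + 1)
    have h4 := hT (2 * k)
    rw [h3, h4]
    rw [h4] at h2
    push_cast at h2 ⊢
    linarith
  · exact fun k => (hev (2 * k) (by omega)).2.2.2.1

end BowenEntropy

/-- **Theorem 3.1.** Let `f` be a topologically mixing homeomorphism of a compact metric space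
with the exponential shadowing property and `A : X → GL(m,ℝ)` a Hölder continuous matrix
function. Then either all ergodic invariant measures have the same maximal Lyapunov exponent
w.r.t. `A`, or the ML-irregular set `MLI(A,f)` has full topological entropy and full packing
topological entropy, and its Bowen–Hausdorff entropy is bounded below by
`sup {h_μ(f) : μ ergodic, μ not Lyapunov-minimizing for A}`. -/
theorem mlIrregular_holder_cocycle_expShadowing
    {X : Type*} [MetricSpace X] [CompactSpace X] [MeasurableSpace X] [BorelSpace X] {m : ℕ}
    (f : X ≃ₜ X) (hmix : TopMixingOn (⇑f) univ) (hshadow : ExpShadowing f.toEquiv)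
    (A : X → (Em m ≃L[ℝ] Em m)) (hA : HolderMat A) :
    (∀ μ ν : Measure X, IsProbabilityMeasure μ → IsProbabilityMeasure ν →
        Ergodic (⇑f) μ → Ergodic (⇑f) ν → mle (⇑f) A μ = mle (⇑f) A ν) ∨
    (topEnt (⇑f) (MLIrr (⇑f) A) = topEnt (⇑f) univ ∧
      packEnt (⇑f) (MLIrr (⇑f) A) = topEnt (⇑f) univ ∧
      sSup {h : EReal | ∃ μ : Measure X, IsProbabilityMeasure μ ∧ Ergodic (⇑f) μ ∧
          ¬ IsLyapMin (⇑f) A μ ∧ h = ksEnt (⇑f) μ}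
        ≤ bowenEnt (⇑f) (MLIrr (⇑f) A)) := by
  by_cases hall : ∀ μ ν : Measure X, IsProbabilityMeasure μ → IsProbabilityMeasure ν →
      Ergodic (⇑f) μ → Ergodic (⇑f) ν → mle (⇑f) A μ = mle (⇑f) A ν
  · exact Or.inl hall
  refine Or.inr ?_
  rcases Nat.eq_zero_or_pos m with rfl | hm
  · exact absurd (fun μ ν _ _ _ _ => by simp only [mle_eq_zero_of_dim_eq_zero]) hall
  have : NeZero m := ⟨hm.ne'⟩
  have hf : Continuous (f.toEquiv : X → X) := f.continuous
  obtain ⟨lam, hlam, hs⟩ := hshadow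
  obtain ⟨μ, ν, hμp, hνp, hμ, hν, hlt⟩ : ∃ μ ν : Measure X, IsProbabilityMeasure μ ∧
      IsProbabilityMeasure ν ∧ MeasurePreserving f μ μ ∧ MeasurePreserving f ν ν ∧
      mle f A ν < mle f A μ := by
    push Not at hall
    obtain ⟨μ, ν, hμp, hνp, hμ, hν, hne⟩ := hall
    rcases lt_or_gt_of_ne hne with h | h
    · exact ⟨ν, μ, hνp, hμp, hν.toMeasurePreserving, hμ.toMeasurePreserving, h⟩
    · exact ⟨μ, ν, hμp, hνp, hμ.toMeasurePreserving, hν.toMeasurePreserving, h⟩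
  have : Nonempty X := μ.nonempty_of_neZero
  have hhorse : ∀ t : ℝ, (t : EReal) < topEnt f univ →
      (t : EReal) ≤ topEnt f (MLIrr f A) ∧ (t : EReal) ≤ packEnt f (MLIrr f A) := fun t ht => by
    obtain ⟨r, htr, hr⟩ := EReal.lt_iff_exists_real_btwn.1 ht
    have htr' : t < r := by exact_mod_cast htr
    obtain ⟨ε, hε, hsep⟩ := exists_frequently_large_isDynSep f.continuous hr
    obtain ⟨n, T, S, E, hE, hEirr, hhs⟩ :=
      exists_irregular_horseshoe hf hmix hlam hs hA μ ν hμ hν hlt hε hsep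
    exact ⟨(hhs.le_compactEnt hf hε htr').trans
      (le_iSup_of_le E (le_iSup_of_le hE (le_iSup_of_le hEirr le_rfl))),
      hhs.le_packEnt hEirr hε htr'⟩
  refine ⟨le_antisymm (topEnt_mono (subset_univ _))
      (EReal.ge_of_forall_gt_iff_ge.1 fun t ht => (hhorse t ht).1),
    le_antisymm (packEnt_le_topEnt f.continuous _)
      (EReal.ge_of_forall_gt_iff_ge.1 fun t ht => (hhorse t ht).2), sSup_le ?_⟩
  rintro _ ⟨μ', hμ'p, hμ'e, hmin, rfl⟩
  obtain ⟨ν', hν'p, hν', hlt'⟩ :=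
    exists_mle_lt_of_not_isLyapMin f.continuous hA hμ'e.toMeasurePreserving hmin
  exact ksEnt_le_bowenEnt_MLIrr hf hmix hlam hs hA μ' ν' hμ'e hν' hlt'
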